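/- Let W_H be a fractional Brownian motion with Hurst index H = 1 − α/2 ∈ (1/2, 1). For T > 0 let a_T be a nondecreasing function of T with 0 < a_T ≤ T and a_T/T nonincreasing. Then limsup_{T→∞} sup_{0 ≤ t ≤ T − a_T} sup_{0 ≤ s ≤ a_T} |W_H(t+s) − W_H(t)| / (a_T^H (2(log(T/a_T) + log log T))^{1/2}) = 1 almost surely. -/

import Mathlib

open MeasureTheory ProbabilityTheory Filter

/-- A fractional Brownian motion with Hurst index `H`: a centered Gaussian
process (all finite linear combinations of values are Gaussian) with
covariance `(s^{2H} + t^{2H} − |s−t|^{2H})/2` on `[0,∞)`, continuous paths,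
started at `0`. -/
def IsFractionalBM {Ω : Type} [MeasurableSpace Ω] (P : Measure Ω)
    (H : ℝ) (W : ℝ → Ω → ℝ) : Prop :=
  (∀ t, Measurable (W t)) ∧
  (∀ (n : ℕ) (t : Fin n → ℝ) (c : Fin n → ℝ), (∀ i, 0 ≤ t i) →
    ∃ v : NNReal, P.map (fun ω => ∑ i, c i * W (t i) ω) = gaussianReal 0 v) ∧
  (∀ t : ℝ, 0 ≤ t → ∫ ω, W t ω ∂P = 0) ∧
  (∀ s t : ℝ, 0 ≤ s → 0 ≤ t →
    ∫ ω, W s ω * W t ω ∂P = (s ^ (2*H) + t ^ (2*H) - |s - t| ^ (2*H)) / 2) ∧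
  (∀ ω, Continuous fun t => W t ω) ∧ (∀ ω, W 0 ω = 0)

lemma gaussianPDF_anti_abs (v : NNReal) {x y : ℝ} (h : |x| ≤ |y|) :
    gaussianPDF 0 v y ≤ gaussianPDF 0 v x := by
  unfold gaussianPDF gaussianPDFReal
  have h2 : x ^ 2 ≤ y ^ 2 := sq_le_sq.mpr h
  simp only [sub_zero]
  gcongr

lemma gaussianReal_Icc_shift_le {v : NNReal} (hv : v ≠ 0) (u y : ℝ) :
    gaussianReal 0 v (Set.Icc (-u - y) (u - y)) ≤ gaussianReal 0 v (Set.Icc (-u) u) := by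
  set A := Set.Icc (-u - y) (u - y)
  set B := Set.Icc (-u) u
  have hvol : volume A = volume B := by
    simp only [A, B, Real.volume_Icc]; congr 1; ring
  have hA : MeasurableSet A := measurableSet_Icc
  have hB : MeasurableSet B := measurableSet_Icc
  have hdiff : volume (A \ B) = volume (B \ A) := by
    have h1 := measure_inter_add_sdiff (μ := volume) A hB
    have h2 := measure_inter_add_sdiff (μ := volume) B hA
    rw [Set.inter_comm] at h2
    rw [← hvol, ← h1] at h2
    have hfin : volume (A ∩ B) ≠ ⊤ :=
      ((measure_mono Set.inter_subset_left).trans_lt (by simp [A])).ne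
    exact ((ENNReal.add_right_inj hfin).mp h2).symm
  have key : gaussianReal 0 v (A \ B) ≤ gaussianReal 0 v (B \ A) := by
    rw [gaussianReal_apply _ hv, gaussianReal_apply _ hv]
    rcases lt_or_ge u 0 with hu | hu
    · have : A = ∅ := by simp only [A]; exact Set.Icc_eq_empty (by linarith)
      simp [this]
    calc ∫⁻ x in A \ B, gaussianPDF 0 v x
        ≤ ∫⁻ _ in A \ B, gaussianPDF 0 v u := by
          refine setLIntegral_mono' (hA.diff hB) fun x hx => ?_
          apply gaussianPDF_anti_abs
          rw [abs_of_nonneg hu]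
          by_contra hcon
          exact hx.2 (abs_le.mp (not_le.mp hcon).le)
      _ = ∫⁻ _ in B \ A, gaussianPDF 0 v u := by simp [hdiff]
      _ ≤ ∫⁻ x in B \ A, gaussianPDF 0 v x := by
          refine setLIntegral_mono' (hB.diff hA) fun x hx => ?_
          apply gaussianPDF_anti_abs
          rw [abs_of_nonneg hu]
          exact abs_le.mpr hx.1
  rw [← measure_inter_add_sdiff A hB, ← measure_inter_add_sdiff B hA, Set.inter_comm B A]
  gcongr

lemma memLp_two_of_map_gaussian {Ω : Type} [MeasurableSpace Ω] {P : Measure Ω}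
    {X : Ω → ℝ} (hX : Measurable X) {v : NNReal} (h : P.map X = gaussianReal 0 v) :
    MemLp X 2 P := by
  have := memLp_id_gaussianReal' (μ := 0) (v := v) 2 (by simp)
  rw [← h, memLp_map_measure_iff aestronglyMeasurable_id hX.aemeasurable] at this
  exact this

lemma integral_sq_of_map_gaussian {Ω : Type} [MeasurableSpace Ω] {P : Measure Ω}
    {X : Ω → ℝ} (hX : Measurable X) {v : NNReal} (h : P.map X = gaussianReal 0 v) :
    ∫ ω, X ω ^ 2 ∂P = v := by
  have h1 : ∫ x, x ^ 2 ∂(gaussianReal 0 v) = v := by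
    have := variance_fun_id_gaussianReal (μ := 0) (v := v)
    rw [variance_eq_integral (by fun_prop)] at this
    simpa using this
  rw [← h, integral_map hX.aemeasurable (by fun_prop)] at h1
  exact h1

lemma measure_abs_gt_le_of_map_gaussian {Ω : Type} [MeasurableSpace Ω] {P : Measure Ω}
    [IsProbabilityMeasure P]
    {X : Ω → ℝ} (hX : Measurable X) {v : NNReal} (h : P.map X = gaussianReal 0 v)
    {V x : ℝ} (hV : 0 < V) (hvV : (v : ℝ) ≤ V) (hx : 0 ≤ x) :
    P {ω | x < |X ω|} ≤ ENNReal.ofReal (2 * Real.exp (-(x ^ 2 / (2 * V)))) := by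
  have tail : ∀ Y : Ω → ℝ, Measurable Y → P.map Y = gaussianReal 0 v →
      P.real {ω | x ≤ Y ω} ≤ Real.exp (-(x ^ 2 / (2 * V))) := by
    intro Y hY hmap
    have hint : Integrable (fun ω => Real.exp (x / V * Y ω)) P := by
      have := integrable_exp_mul_gaussianReal (μ := 0) (v := v) (x / V)
      rw [← hmap, integrable_map_measure (by fun_prop) hY.aemeasurable] at this
      exact this
    have h1 := measure_ge_le_exp_mul_mgf (μ := P) (X := Y) x (t := x / V) (by positivity) hint
    rw [mgf_gaussianReal hmap, ← Real.exp_add] at h1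
    refine h1.trans (Real.exp_le_exp.mpr ?_)
    have h2 : (v : ℝ) * (x / V) ^ 2 ≤ V * (x / V) ^ 2 := by gcongr
    have h3 : V * (x / V) ^ 2 = x ^ 2 / V := by field_simp
    have h4 : -(x ^ 2 / (2 * V)) = - (x / V) * x + x ^ 2 / V / 2 := by field_simp; ring
    rw [h4]
    linarith
  have hneg : P.map (fun ω => - X ω) = gaussianReal 0 v := by
    have : (P.map X).map (fun x => -x) = gaussianReal 0 v := by
      rw [h, gaussianReal_map_neg]; simp
    rwa [Measure.map_map (by fun_prop) hX] at this
  have h1 := tail X hX h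
  have h2 := tail (fun ω => - X ω) hX.neg hneg
  have hsub : {ω | x < |X ω|} ⊆ {ω | x ≤ X ω} ∪ {ω | x ≤ - X ω} := by
    intro ω hω
    rcases lt_abs.mp (show x < |X ω| from hω) with h | h
    · exact Or.inl h.le
    · exact Or.inr h.le
  have h3 : P.real {ω | x < |X ω|} ≤ 2 * Real.exp (-(x ^ 2 / (2 * V))) := by
    refine (measureReal_mono hsub).trans ((measureReal_union_le _ _).trans ?_)
    linarith
  rw [← ofReal_measureReal]
  exact ENNReal.ofReal_le_ofReal h3

/-- A Gaussian vector whose covariance form dominates `κ` times the identity is at most as likely to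
lie in a centred box as a vector of independent centred Gaussians of variance `κ`. -/
lemma gaussian_box_le {Ω : Type} [MeasurableSpace Ω] {P : Measure Ω} [IsProbabilityMeasure P]
    {ι : Type} [Fintype ι] (ξ : ι → Ω → ℝ) (hm : ∀ i, Measurable (ξ i))
    (hG : ∀ c : ι → ℝ, ∃ v : NNReal, P.map (fun ω => ∑ i, c i * ξ i ω) = gaussianReal 0 v)
    {κ : NNReal} (hκ : κ ≠ 0)
    (hlow : ∀ c : ι → ℝ, κ * ∑ i, c i ^ 2 ≤ ∫ ω, (∑ i, c i * ξ i ω) ^ 2 ∂P) (u : ι → ℝ) :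
    P {ω | ∀ i, |ξ i ω| ≤ u i} ≤ ∏ i, gaussianReal 0 κ (Set.Icc (-u i) (u i)) := by
  classical
  have hmemLp : ∀ i, MemLp (ξ i) 2 P := by
    intro i
    obtain ⟨v, hv⟩ := hG (Pi.single i 1)
    refine memLp_two_of_map_gaussian (v := v) (hm i) ?_
    convert hv using 2
    ext ω
    simp [Pi.single_apply]
  have hint : ∀ i j, Integrable (fun ω => ξ i ω * ξ j ω) P := fun i j =>
    (hmemLp i).integrable_mul (hmemLp j)
  let S : Matrix ι ι ℝ := Matrix.of (fun i j => ∫ ω, ξ i ω * ξ j ω ∂P)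
  have hquad : ∀ c : ι → ℝ, ∫ ω, (∑ i, c i * ξ i ω) ^ 2 ∂P = c ⬝ᵥ S.mulVec c := by
    intro c
    have : ∀ ω, (∑ i, c i * ξ i ω) ^ 2 = ∑ i, ∑ j, c i * c j * (ξ i ω * ξ j ω) := by
      intro ω
      rw [sq, Finset.sum_mul_sum]
      refine Finset.sum_congr rfl fun i _ => Finset.sum_congr rfl fun j _ => by ring
    simp_rw [this]
    rw [integral_finsetSum _ fun i _ => integrable_finsetSum _ fun j _ => (hint i j).const_mul _]
    simp only [dotProduct, Matrix.mulVec, S, Matrix.of_apply, Finset.mul_sum]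
    refine Finset.sum_congr rfl fun i _ => ?_
    rw [integral_finsetSum _ fun j _ => (hint i j).const_mul _]
    refine Finset.sum_congr rfl fun j _ => ?_
    rw [integral_const_mul]; ring
  let S' : Matrix ι ι ℝ := S - (κ : ℝ) • (1 : Matrix ι ι ℝ)
  have hS'quad : ∀ c : ι → ℝ, c ⬝ᵥ S'.mulVec c = c ⬝ᵥ S.mulVec c - κ * ∑ i, c i ^ 2 := by
    intro c
    simp only [S', Matrix.sub_mulVec, Matrix.smul_mulVec, Matrix.one_mulVec, dotProduct,
      Pi.sub_apply, Pi.smul_apply, smul_eq_mul, mul_sub, Finset.sum_sub_distrib, Finset.mul_sum]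
    congr 1
    exact Finset.sum_congr rfl fun i _ => by ring
  have hS' : S'.PosSemidef := by
    refine Matrix.PosSemidef.of_dotProduct_mulVec_nonneg ?_ ?_
    · ext i j
      simp only [S', S, Matrix.conjTranspose_apply, Matrix.sub_apply, Matrix.of_apply,
        Matrix.smul_apply, Matrix.one_apply, star_trivial]
      congr 1
      · simp_rw [mul_comm]
      · simp [eq_comm]
    · intro c
      have := hlow c
      rw [star_trivial, hS'quad, ← hquad]
      linarith
  let γ : Measure (EuclideanSpace ℝ ι) :=
    (Measure.pi fun _ : ι => gaussianReal 0 κ).map (WithLp.toLp 2)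
  have hγp : IsProbabilityMeasure γ :=
    Measure.isProbabilityMeasure_map (WithLp.measurable_toLp 2 _).aemeasurable
  let Ξ : Ω → EuclideanSpace ℝ ι := fun ω => WithLp.toLp 2 (fun i => ξ i ω)
  have hΞ : Measurable Ξ := (WithLp.measurable_toLp 2 _).comp (measurable_pi_lambda _ hm)
  have hΞp : IsProbabilityMeasure (P.map Ξ) := Measure.isProbabilityMeasure_map hΞ.aemeasurable
  have hlaw : P.map Ξ = (multivariateGaussian 0 S').conv γ := by
    refine Measure.ext_of_charFun (funext fun t => ?_)
    rw [charFun_conv, charFun_multivariateGaussian hS', charFun_pi]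
    obtain ⟨v, hv⟩ := hG t
    have hmeas : Measurable fun ω => ∑ i, t i * ξ i ω := by fun_prop
    have hv2 := integral_sq_of_map_gaussian hmeas hv
    rw [hquad] at hv2
    have h1 : charFun (P.map Ξ) t = charFun (P.map (fun ω => ∑ i, t i * ξ i ω)) 1 := by
      rw [charFun_apply, charFun_apply, integral_map hΞ.aemeasurable (by fun_prop),
        integral_map hmeas.aemeasurable (by fun_prop)]
      refine integral_congr_ae (Eventually.of_forall fun ω => ?_)
      simp [Ξ, PiLp.inner_apply]
    rw [h1, hv, charFun_gaussianReal]
    simp_rw [charFun_gaussianReal]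
    rw [← Complex.exp_sum, ← Complex.exp_add, hS'quad, hv2]
    congr 1
    push_cast
    simp only [inner_zero_right, Complex.ofReal_zero, zero_mul, zero_sub, mul_zero, one_pow,
      mul_one, Finset.sum_neg_distrib, ← Finset.sum_div, ← Finset.mul_sum]
    ring
  let B : Set (EuclideanSpace ℝ ι) := {x | ∀ i, |x i| ≤ u i}
  have hB : MeasurableSet B := by
    have : B = ⋂ i, {x : EuclideanSpace ℝ ι | |x i| ≤ u i} := by ext; simp [B]
    rw [this]
    refine MeasurableSet.iInter fun i => ?_
    have : Measurable fun x : EuclideanSpace ℝ ι => x i := by fun_prop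
    exact measurableSet_le this.abs measurable_const
  have h1 : P {ω | ∀ i, |ξ i ω| ≤ u i} = (P.map Ξ) B := by
    rw [Measure.map_apply hΞ hB]; rfl
  rw [h1, hlaw, ← lintegral_indicator_one hB,
    Measure.lintegral_conv (measurable_one.indicator hB)]
  calc _ ≤ ∫⁻ _, (∏ i, gaussianReal 0 κ (Set.Icc (-u i) (u i))) ∂(multivariateGaussian 0 S') := by
        refine lintegral_mono fun x => ?_
        rw [lintegral_map (by fun_prop (disch := exact hB)) (WithLp.measurable_toLp 2 _)]
        have : ∀ y : ι → ℝ, B.indicator (1 : EuclideanSpace ℝ ι → ENNReal) (x + WithLp.toLp 2 y) =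
            (Set.univ.pi fun i => Set.Icc (-u i - x i) (u i - x i)).indicator 1 y := by
          intro y
          simp only [Set.indicator_apply]
          congr 1
          simp only [B, Set.mem_ofPred_eq, Set.mem_pi, Set.mem_univ, true_imp_iff, Set.mem_Icc,
            eq_iff_iff, PiLp.add_apply, abs_le]
          refine forall_congr' fun i => ?_
          constructor <;> rintro ⟨h1, h2⟩ <;> constructor <;> linarith
        simp_rw [this]
        rw [lintegral_indicator_one (MeasurableSet.univ_pi fun i => measurableSet_Icc),
          Measure.pi_pi]
        exact Finset.prod_le_prod' fun i _ => gaussianReal_Icc_shift_le hκ _ _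
    _ = _ := by simp

/-- Lower bound for the two-sided Gaussian tail, with an arbitrarily small loss in the exponent. -/
lemma gaussianReal_Icc_le {κ : NNReal} (hκ : κ ≠ 0) {η : ℝ} (hη : 0 < η) :
    ∃ c : ℝ, 0 < c ∧ ∀ x : ℝ, 0 ≤ x → gaussianReal 0 κ (Set.Icc (-x) x) ≤
      ENNReal.ofReal (Real.exp (-(c * Real.exp (-((1 + η) * x ^ 2 / (2 * κ)))))) := by
  have hκ' : (0 : ℝ) < κ := NNReal.coe_pos.mpr (pos_iff_ne_zero.mpr hκ)
  refine ⟨(Real.sqrt (2 * Real.pi * κ))⁻¹ * Real.exp (-((1 + 1 / η) / (2 * κ))), by positivity,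
    fun x hx => ?_⟩
  set c := (Real.sqrt (2 * Real.pi * κ))⁻¹ * Real.exp (-((1 + 1 / η) / (2 * κ)))
  set p := c * Real.exp (-((1 + η) * x ^ 2 / (2 * κ)))
  have hp : p ≤ gaussianPDFReal 0 κ (x + 1) := by
    simp only [p, c, gaussianPDFReal, mul_assoc]
    rw [← Real.exp_add]
    gcongr
    rw [← neg_add, ← add_div, neg_div]
    gcongr
    have : 0 ≤ (η * x - 1) ^ 2 / η := by positivity
    have e : (η * x - 1) ^ 2 / η = η * x ^ 2 - 2 * x + 1 / η := by field_simp; ring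
    nlinarith
  have htail : ENNReal.ofReal p ≤ gaussianReal 0 κ (Set.Ioc x (x + 1)) := by
    rw [gaussianReal_apply _ hκ]
    calc ENNReal.ofReal p = ∫⁻ _ in Set.Ioc x (x + 1), ENNReal.ofReal p := by simp
      _ ≤ _ := by
        refine setLIntegral_mono' measurableSet_Ioc fun y hy => ?_
        refine (ENNReal.ofReal_le_ofReal hp).trans ?_
        refine gaussianPDF_anti_abs κ ?_
        rw [abs_of_nonneg (by linarith [hy.1]), abs_of_nonneg (by linarith)]
        exact hy.2
  have hdisj : Disjoint (Set.Icc (-x) x) (Set.Ioc x (x + 1)) :=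
    Set.disjoint_left.mpr fun y h1 h2 => absurd h1.2 (not_le.mpr h2.1)
  have hsum : gaussianReal 0 κ (Set.Icc (-x) x) + ENNReal.ofReal p ≤ 1 := by
    calc _ ≤ gaussianReal 0 κ (Set.Icc (-x) x) + gaussianReal 0 κ (Set.Ioc x (x + 1)) := by gcongr
      _ = gaussianReal 0 κ (Set.Icc (-x) x ∪ Set.Ioc x (x + 1)) :=
          (measure_union hdisj measurableSet_Ioc).symm
      _ ≤ 1 := prob_le_one
  calc gaussianReal 0 κ (Set.Icc (-x) x) ≤ 1 - ENNReal.ofReal p :=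
        ENNReal.le_sub_of_add_le_right ENNReal.ofReal_ne_top hsum
    _ = ENNReal.ofReal (1 - p) := by
        rw [ENNReal.ofReal_sub _ (by positivity), ENNReal.ofReal_one]
    _ ≤ _ := ENNReal.ofReal_le_ofReal (by linarith [Real.add_one_le_exp (-p)])

/-- Length of the intersection of `[s, t]` with `[z.1, z.1 + z.2]` (for `s ≤ t` and `0 ≤ z.2`). -/
noncomputable def clampInc (s t : ℝ) (z : ℝ × ℝ) : ℝ :=
  max z.1 (min t (z.1 + z.2)) - max z.1 (min s (z.1 + z.2))

noncomputable def scaleWeight (H : ℝ) (z : ℝ × ℝ) : ℝ :=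
  if 0 < z.2 then z.2 ^ (2 * H - 4) else 0

lemma continuous_clampInc (s t : ℝ) : Continuous (clampInc s t) := by
  unfold clampInc; fun_prop

lemma measurable_scaleWeight (H : ℝ) : Measurable (scaleWeight H) := by
  unfold scaleWeight
  exact Measurable.ite (measurableSet_lt measurable_const measurable_snd)
    (measurable_snd.pow_const _) measurable_const

lemma scaleWeight_nonneg (H : ℝ) (z : ℝ × ℝ) : 0 ≤ scaleWeight H z := by
  unfold scaleWeight; split_ifs <;> positivity

lemma clampInc_ne_zero {s t : ℝ} {z : ℝ × ℝ} (hst : s ≤ t)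
    (h : clampInc s t z ≠ 0) : z.1 < t ∧ s < z.1 + z.2 := by
  unfold clampInc at h
  constructor
  · by_contra hcon
    apply h
    rw [max_eq_left ((min_le_left _ _).trans (not_lt.mp hcon)),
      max_eq_left ((min_le_left _ _).trans (hst.trans (not_lt.mp hcon))), sub_self]
  · by_contra hcon
    apply h
    rw [min_eq_right (not_lt.mp hcon), min_eq_right ((not_lt.mp hcon).trans hst), sub_self]

lemma abs_clampInc_zero_one_le {z : ℝ × ℝ} (hz : 0 < z.2) :
    |clampInc 0 1 z| ≤ 1 ∧ |clampInc 0 1 z| ≤ z.2 := by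
  unfold clampInc
  constructor <;> rw [abs_le] <;> constructor <;>
    rcases max_cases z.1 (min 1 (z.1 + z.2)) with h1 | h1 <;>
    rcases max_cases z.1 (min 0 (z.1 + z.2)) with h2 | h2 <;>
    rcases min_cases 1 (z.1 + z.2) with h3 | h3 <;>
    rcases min_cases 0 (z.1 + z.2) with h4 | h4 <;> linarith

lemma integrable_clampInc_sq {H : ℝ} (h0 : 1 / 2 < H) (h1 : H < 1) :
    Integrable (fun z => clampInc 0 1 z ^ 2 * scaleWeight H z) := by
  let f : ℝ → ℝ := fun p => 2 ^ (2 - H) * (1 + |p|) ^ (H - 2)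
  let g : ℝ → ℝ := fun r => (Set.Ioc (0:ℝ) 1).indicator (fun r => r ^ (2 * H - 2)) r +
    (Set.Ioi (1:ℝ)).indicator (fun r => r ^ (H - 2)) r
  have hf : Integrable f := by
    have := integrable_one_add_norm (E := ℝ) (μ := volume) (r := 2 - H)
      (by simp; linarith)
    simp only [Real.norm_eq_abs, neg_sub] at this
    exact this.const_mul _
  have hg : Integrable g := by
    refine Integrable.add ?_ ?_
    · rw [integrable_indicator_iff measurableSet_Ioc,
        ← intervalIntegrable_iff_integrableOn_Ioc_of_le zero_le_one]
      exact intervalIntegral.intervalIntegrable_rpow' (by linarith)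
    · rw [integrable_indicator_iff measurableSet_Ioi]
      exact integrableOn_Ioi_rpow_of_lt (by linarith) one_pos
  have hfg : Integrable (fun z : ℝ × ℝ => f z.1 * g z.2) := hf.mul_prod hg
  refine hfg.mono' ?_ (Eventually.of_forall fun z => ?_)
  · exact (((continuous_clampInc 0 1).measurable.pow_const 2).mul
      (measurable_scaleWeight H)).aestronglyMeasurable
  have hf0 : ∀ p, 0 ≤ f p := fun p => by positivity
  have hg0 : ∀ r, 0 ≤ g r := fun r => add_nonneg
    (Set.indicator_nonneg (fun x hx => Real.rpow_nonneg hx.1.le _) _)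
    (Set.indicator_nonneg (fun x hx => Real.rpow_nonneg (zero_le_one.trans (Set.mem_Ioi.mp hx).le) _) _)
  rw [Real.norm_of_nonneg (mul_nonneg (sq_nonneg _) (scaleWeight_nonneg _ _))]
  by_cases hz : 0 < z.2
  swap
  · simpa [scaleWeight, hz] using mul_nonneg (hf0 _) (hg0 _)
  by_cases hc : clampInc 0 1 z = 0
  · simpa [hc] using mul_nonneg (hf0 _) (hg0 _)
  obtain ⟨hlt, hgt⟩ := clampInc_ne_zero zero_le_one hc
  obtain ⟨b1, b2⟩ := abs_clampInc_zero_one_le hz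
  rw [← sq_abs]
  simp only [scaleWeight, hz, if_true]
  rcases le_or_gt z.2 1 with hr | hr
  · have hp : |z.1| ≤ 1 := abs_le.mpr ⟨by linarith, by linarith⟩
    have hf1 : 1 ≤ f z.1 := by
      have : (2:ℝ) ^ (H - 2) ≤ (1 + |z.1|) ^ (H - 2) :=
        Real.rpow_le_rpow_of_nonpos (by positivity) (by linarith) (by linarith)
      calc (1:ℝ) = 2 ^ (2 - H) * 2 ^ (H - 2) := by
            rw [← Real.rpow_add two_pos]; simp
        _ ≤ f z.1 := by simp only [f]; gcongr
    have hg1 : g z.2 = z.2 ^ (2 * H - 2) := by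
      simp [g, hz, hr]
    calc |clampInc 0 1 z| ^ 2 * z.2 ^ (2 * H - 4) ≤ z.2 ^ 2 * z.2 ^ (2 * H - 4) := by gcongr
      _ = 1 * g z.2 := by
          rw [hg1, ← Real.rpow_natCast, ← Real.rpow_add hz]; norm_num; ring_nf
      _ ≤ _ := by gcongr; exact hg0 _
  · have hp : |z.1| ≤ z.2 := abs_le.mpr ⟨by linarith, by linarith⟩
    have hg1 : g z.2 = z.2 ^ (H - 2) := by
      simp [g, hr]
    calc |clampInc 0 1 z| ^ 2 * z.2 ^ (2 * H - 4) ≤ 1 ^ 2 * z.2 ^ (2 * H - 4) := by gcongr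
      _ = z.2 ^ (H - 2) * g z.2 := by
          rw [hg1, ← Real.rpow_add hz]; ring_nf
      _ ≤ _ := by
        gcongr
        · exact hg0 _
        · simp only [f]
          calc z.2 ^ (H - 2) = 2 ^ (2 - H) * (2 * z.2) ^ (H - 2) := by
                rw [Real.mul_rpow two_pos.le hz.le, ← mul_assoc, ← Real.rpow_add two_pos]; simp
            _ ≤ _ := by
              exact mul_le_mul_of_nonneg_left (Real.rpow_le_rpow_of_nonpos (by positivity)
                (by linarith) (by linarith)) (by positivity)

lemma clampInc_affine {s l : ℝ} (hl : 0 < l) (z : ℝ × ℝ) :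
    clampInc s (s + l) z = l * clampInc 0 1 (l⁻¹ • (z - (s, 0))) := by
  unfold clampInc
  simp only [Prod.smul_fst, Prod.fst_sub, Prod.smul_snd, Prod.snd_sub, smul_eq_mul, sub_zero]
  have e : ∀ a b : ℝ, l * max a b = max (l * a) (l * b) := fun a b => mul_max_of_nonneg a b hl.le
  have e' : ∀ a b : ℝ, l * min a b = min (l * a) (l * b) := fun a b => mul_min_of_nonneg a b hl.le
  have h1 : l * (l⁻¹ * (z.1 - s) + l⁻¹ * z.2) = z.1 + z.2 - s := by field_simp; ring
  have h2 : l * (l⁻¹ * (z.1 - s)) = z.1 - s := by field_simp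
  rw [mul_sub, e, e', e, e', h1, h2, mul_one, mul_zero]
  have e3 : min l (z.1 + z.2 - s) = min (s + l) (z.1 + z.2) - s := by
    rw [← min_sub_sub_right]; ring_nf
  have e4 : min 0 (z.1 + z.2 - s) = min s (z.1 + z.2) - s := by
    rw [← min_sub_sub_right]; ring_nf
  rw [e3, e4, max_sub_sub_right, max_sub_sub_right]
  ring

lemma scaleWeight_affine (H : ℝ) {s l : ℝ} (hl : 0 < l) (z : ℝ × ℝ) :
    scaleWeight H z = l ^ (2 * H - 4) * scaleWeight H (l⁻¹ • (z - (s, 0))) := by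
  unfold scaleWeight
  simp only [Prod.smul_snd, Prod.snd_sub, smul_eq_mul, sub_zero]
  by_cases hz : 0 < z.2
  · have : 0 < l⁻¹ * z.2 := by positivity
    rw [if_pos hz, if_pos this, ← Real.mul_rpow hl.le this.le, mul_inv_cancel_left₀ hl.ne']
  · have : ¬ 0 < l⁻¹ * z.2 := by
      rw [mul_pos_iff_of_pos_left (by positivity)]; exact hz
    rw [if_neg hz, if_neg this, mul_zero]

/-- Mass of the squared unit clamp increment carried by the windows of length at most `M`. -/
noncomputable def clampMass (H : ℝ) (A : Set ℝ) : ℝ :=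
  ∫ z : ℝ × ℝ, A.indicator 1 z.2 * (clampInc 0 1 z ^ 2 * scaleWeight H z)

lemma integrable_indicator_clampInc_sq {H : ℝ} (h0 : 1 / 2 < H) (h1 : H < 1) {A : Set ℝ}
    (hA : MeasurableSet A) :
    Integrable (fun z : ℝ × ℝ => A.indicator 1 z.2 * (clampInc 0 1 z ^ 2 * scaleWeight H z)) := by
  refine (integrable_clampInc_sq h0 h1).bdd_mul (c := 1) ?_ (Eventually.of_forall fun z => ?_)
  · exact ((measurable_one.indicator hA).comp measurable_snd).aestronglyMeasurable
  · by_cases h : z.2 ∈ A <;> simp [h]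

lemma indicator_clampInc_sq_affine {H : ℝ} (A : Set ℝ) {s l : ℝ} (hl : 0 < l) (z : ℝ × ℝ) :
    A.indicator 1 (l⁻¹ * z.2) * (clampInc s (s + l) z ^ 2 * scaleWeight H z) =
      l ^ (2 * H - 2) * (fun z : ℝ × ℝ => A.indicator 1 z.2 *
        (clampInc 0 1 z ^ 2 * scaleWeight H z)) (l⁻¹ • (z - (s, 0))) := by
  have : l ^ (2 * H - 2) = l ^ 2 * l ^ (2 * H - 4) := by
    rw [← Real.rpow_natCast, ← Real.rpow_add hl]; norm_num; ring_nf
  rw [clampInc_affine hl, scaleWeight_affine H (s := s) hl z, this]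
  simp only [Prod.smul_snd, Prod.snd_sub, smul_eq_mul, sub_zero]
  ring

lemma integrable_indicator_clampInc_sq_affine {H : ℝ} (h0 : 1 / 2 < H) (h1 : H < 1) {A : Set ℝ}
    (hA : MeasurableSet A) {s l : ℝ} (hl : 0 < l) :
    Integrable (fun z : ℝ × ℝ =>
      A.indicator 1 (l⁻¹ * z.2) * (clampInc s (s + l) z ^ 2 * scaleWeight H z)) := by
  simp_rw [indicator_clampInc_sq_affine A hl]
  refine Integrable.const_mul ?_ _
  exact (((integrable_indicator_clampInc_sq h0 h1 hA).comp_smul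
    (inv_ne_zero hl.ne')).comp_sub_right (s, 0))

lemma integral_indicator_clampInc_sq_affine {H : ℝ} (A : Set ℝ) {s l : ℝ} (hl : 0 < l) :
    ∫ z : ℝ × ℝ, A.indicator 1 (l⁻¹ * z.2) * (clampInc s (s + l) z ^ 2 * scaleWeight H z) =
      l ^ (2 * H) * clampMass H A := by
  simp_rw [indicator_clampInc_sq_affine A hl]
  rw [integral_const_mul, clampMass]
  set F := fun z : ℝ × ℝ => A.indicator 1 z.2 * (clampInc 0 1 z ^ 2 * scaleWeight H z)
  rw [integral_sub_right_eq_self (fun z => F (l⁻¹ • z)) ((s, 0) : ℝ × ℝ),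
    Measure.integral_comp_inv_smul, Module.finrank_prod, Module.finrank_self, smul_eq_mul,
    abs_of_nonneg (by positivity), ← mul_assoc]
  congr 1
  rw [← Real.rpow_natCast, ← Real.rpow_add hl]; norm_num

lemma clampMass_univ_pos {H : ℝ} (h0 : 1 / 2 < H) (h1 : H < 1) : 0 < clampMass H Set.univ := by
  have hint := integrable_clampInc_sq h0 h1
  simp only [clampMass, Set.indicator_univ, Pi.one_apply, one_mul]
  rw [integral_pos_iff_support_of_nonneg
    (fun z => mul_nonneg (sq_nonneg _) (scaleWeight_nonneg _ _)) hint]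
  have hopen : IsOpen (Set.Ioo (0:ℝ) 1 ×ˢ Set.Ioi (0:ℝ)) := isOpen_Ioo.prod isOpen_Ioi
  refine (hopen.measure_pos volume ⟨(1 / 2, 1), by norm_num⟩).trans_le (measure_mono ?_)
  rintro ⟨p, r⟩ ⟨⟨hp0, hp1⟩, hr⟩
  simp only at hp0 hp1
  replace hr : 0 < r := hr
  have hw : 0 < scaleWeight H (p, r) := by
    simp only [scaleWeight, hr, if_true]; positivity
  refine (mul_pos (sq_pos_of_ne_zero ?_) hw).ne'
  simp only [clampInc]
  rw [min_eq_left (by linarith : (0:ℝ) ≤ p + r), max_eq_left hp0.le]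
  have : p < max p (min 1 (p + r)) := lt_max_of_lt_right (lt_min hp1 (by linarith))
  linarith

lemma tendsto_clampMass {H : ℝ} (h0 : 1 / 2 < H) (h1 : H < 1) :
    Tendsto (fun n : ℕ => clampMass H (Set.Iic (n : ℝ))) atTop (nhds (clampMass H Set.univ)) := by
  refine tendsto_integral_of_dominated_convergence
    (fun z => clampInc 0 1 z ^ 2 * scaleWeight H z)
    (fun n => (integrable_indicator_clampInc_sq h0 h1 measurableSet_Iic).aestronglyMeasurable)
    (integrable_clampInc_sq h0 h1) (fun n => Eventually.of_forall fun z => ?_)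
    (Eventually.of_forall fun z => ?_)
  · have := mul_nonneg (sq_nonneg (clampInc 0 1 z)) (scaleWeight_nonneg H z)
    rw [norm_mul, Real.norm_of_nonneg this]
    refine mul_le_of_le_one_left this ?_
    by_cases h : z.2 ∈ Set.Iic (n : ℝ) <;> simp only [h, Set.indicator_of_mem,
      Set.indicator_of_notMem, not_false_eq_true, Pi.one_apply] <;> simp
  · refine tendsto_const_nhds.congr' ?_
    obtain ⟨N, hN⟩ := exists_nat_ge z.2
    filter_upwards [eventually_ge_atTop N] with n hn
    have : z.2 ∈ Set.Iic (n : ℝ) := hN.trans (by exact_mod_cast hn)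
    simp [Set.indicator_of_mem this]

lemma integrable_clampInc_sq_of_ne {H : ℝ} (h0 : 1 / 2 < H) (h1 : H < 1) (s t : ℝ) :
    Integrable (fun z => clampInc s t z ^ 2 * scaleWeight H z) := by
  rcases lt_trichotomy s t with h | h | h
  · have := integrable_indicator_clampInc_sq_affine h0 h1 (A := Set.univ) MeasurableSet.univ
      (s := s) (l := t - s) (by linarith)
    simpa using this
  · subst h; simp [clampInc]
  · have := integrable_indicator_clampInc_sq_affine h0 h1 (A := Set.univ) MeasurableSet.univ
      (s := t) (l := s - t) (by linarith)
    simp only [Set.indicator_univ, Pi.one_apply, one_mul, add_sub_cancel] at this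
    refine this.congr (Eventually.of_forall fun z => ?_)
    simp only [clampInc]; ring

lemma integral_clampInc_sq {H : ℝ} (h0 : 1 / 2 < H) (s t : ℝ) :
    ∫ z, clampInc s t z ^ 2 * scaleWeight H z = |t - s| ^ (2 * H) * clampMass H Set.univ := by
  rcases lt_trichotomy s t with h | h | h
  · have := integral_indicator_clampInc_sq_affine (H := H) Set.univ
      (s := s) (l := t - s) (by linarith)
    rw [abs_of_pos (by linarith)]
    simpa using this
  · subst h; simp [clampInc, Real.zero_rpow (by linarith : 2 * H ≠ 0)]
  · have := integral_indicator_clampInc_sq_affine (H := H) Set.univ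
      (s := t) (l := s - t) (by linarith)
    simp only [Set.indicator_univ, Pi.one_apply, one_mul, add_sub_cancel] at this
    rw [abs_sub_comm, abs_of_pos (by linarith : 0 < s - t), ← this]
    refine integral_congr_ae (Eventually.of_forall fun z => ?_)
    simp only [clampInc]; ring

lemma clampInc_mul_eq (H s t s' t' : ℝ) (z : ℝ × ℝ) :
    clampInc s t z * clampInc s' t' z * scaleWeight H z =
      1 / 2 * (clampInc s t' z ^ 2 * scaleWeight H z + clampInc s' t z ^ 2 * scaleWeight H z
        - clampInc t t' z ^ 2 * scaleWeight H z - clampInc s s' z ^ 2 * scaleWeight H z) := by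
  simp only [clampInc]; ring

lemma integral_add_sub_sub {X : Type} [MeasurableSpace X] {μ : Measure X} {a b c d : X → ℝ}
    (ha : Integrable a μ) (hb : Integrable b μ) (hc : Integrable c μ) (hd : Integrable d μ) :
    ∫ x, (a x + b x - c x - d x) ∂μ = ∫ x, a x ∂μ + ∫ x, b x ∂μ - ∫ x, c x ∂μ - ∫ x, d x ∂μ := by
  have h1 : Integrable (fun x => a x + b x) μ := ha.add hb
  have h2 : Integrable (fun x => a x + b x - c x) μ := h1.sub hc
  rw [integral_sub h2 hd, integral_sub h1 hc, integral_add ha hb]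

lemma integrable_clampInc_mul {H : ℝ} (h0 : 1 / 2 < H) (h1 : H < 1) (s t s' t' : ℝ) :
    Integrable (fun z => clampInc s t z * clampInc s' t' z * scaleWeight H z) := by
  simp_rw [clampInc_mul_eq]
  have h := integrable_clampInc_sq_of_ne h0 h1
  exact ((((h s t').add (h s' t)).sub (h t t')).sub (h s s')).const_mul _

lemma integral_clampInc_mul {H : ℝ} (h0 : 1 / 2 < H) (h1 : H < 1) (s t s' t' : ℝ) :
    ∫ z, clampInc s t z * clampInc s' t' z * scaleWeight H z =
      clampMass H Set.univ * (1 / 2 * (|t' - s| ^ (2 * H) + |t - s'| ^ (2 * H)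
        - |t' - t| ^ (2 * H) - |s' - s| ^ (2 * H))) := by
  simp_rw [clampInc_mul_eq]
  have h := integrable_clampInc_sq_of_ne h0 h1
  rw [integral_const_mul, integral_add_sub_sub (h s t') (h s' t) (h t t') (h s s')]
  simp only [integral_clampInc_sq h0]
  ring

section FractionalBM

variable {Ω : Type} [MeasurableSpace Ω] {P : Measure Ω} {H : ℝ} {W : ℝ → Ω → ℝ}

lemma IsFractionalBM.memLp (hW : IsFractionalBM P H W) {t : ℝ} (ht : 0 ≤ t) : MemLp (W t) 2 P := by
  obtain ⟨v, hv⟩ := hW.2.1 1 (fun _ => t) (fun _ => 1) (fun _ => ht)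
  simp only [Finset.univ_unique, one_mul, Finset.sum_const, Finset.card_singleton, one_smul] at hv
  exact memLp_two_of_map_gaussian (hW.1 t) hv

lemma IsFractionalBM.integral_inc_mul_inc (hW : IsFractionalBM P H W) {s t s' t' : ℝ} (hs : 0 ≤ s)
    (ht : 0 ≤ t) (hs' : 0 ≤ s') (ht' : 0 ≤ t') :
    ∫ ω, (W t ω - W s ω) * (W t' ω - W s' ω) ∂P = 1 / 2 * (|t' - s| ^ (2 * H) + |t - s'| ^ (2 * H)
        - |t' - t| ^ (2 * H) - |s' - s| ^ (2 * H)) := by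
  have hi : ∀ {a b : ℝ}, 0 ≤ a → 0 ≤ b → Integrable (fun ω => W a ω * W b ω) P := fun ha hb =>
    (hW.memLp ha).integrable_mul (hW.memLp hb)
  have e : ∀ ω, (W t ω - W s ω) * (W t' ω - W s' ω) =
      W t ω * W t' ω + W s ω * W s' ω - W t ω * W s' ω - W s ω * W t' ω := fun ω => by ring
  simp_rw [e]
  rw [integral_add_sub_sub (hi ht ht') (hi hs hs') (hi ht hs') (hi hs ht')]
  rw [hW.2.2.2.1 t t' ht ht', hW.2.2.2.1 t s' ht hs', hW.2.2.2.1 s t' hs ht',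
    hW.2.2.2.1 s s' hs hs', abs_sub_comm t' s, abs_sub_comm t' t, abs_sub_comm s' s]
  ring

lemma IsFractionalBM.integrable_inc_mul_inc (hW : IsFractionalBM P H W) {s t s' t' : ℝ} (hs : 0 ≤ s)
    (ht : 0 ≤ t) (hs' : 0 ≤ s') (ht' : 0 ≤ t') :
    Integrable (fun ω => (W t ω - W s ω) * (W t' ω - W s' ω)) P :=
  ((hW.memLp ht).sub (hW.memLp hs)).integrable_mul ((hW.memLp ht').sub (hW.memLp hs'))

lemma sum_mul_sq_expand {ι : Type} [Fintype ι] (c y : ι → ℝ) :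
    (∑ i, c i * y i) ^ 2 = ∑ i, ∑ j, c i * c j * (y i * y j) := by
  rw [sq, Finset.sum_mul_sum]
  exact Finset.sum_congr rfl fun i _ => Finset.sum_congr rfl fun j _ => by ring

lemma IsFractionalBM.integral_sum_sq (hW : IsFractionalBM P H W) {ι : Type} [Fintype ι]
    {s t : ι → ℝ} (hs : ∀ i, 0 ≤ s i) (ht : ∀ i, 0 ≤ t i) (c : ι → ℝ) :
    ∫ ω, (∑ i, c i * (W (t i) ω - W (s i) ω)) ^ 2 ∂P =
      ∑ i, ∑ j, c i * c j * ∫ ω, (W (t i) ω - W (s i) ω) * (W (t j) ω - W (s j) ω) ∂P := by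
  simp_rw [sum_mul_sq_expand]
  have hi := fun i j => (hW.integrable_inc_mul_inc (hs i) (ht i) (hs j) (ht j)).const_mul
    (c i * c j)
  rw [integral_finsetSum _ fun i _ => integrable_finsetSum _ fun j _ => hi i j]
  refine Finset.sum_congr rfl fun i _ => ?_
  rw [integral_finsetSum _ fun j _ => hi i j]
  exact Finset.sum_congr rfl fun j _ => integral_const_mul _ _

lemma sum_clampInc_sq_expand (H : ℝ) {ι : Type} [Fintype ι] (s t c : ι → ℝ) (z : ℝ × ℝ) :
    (∑ i, c i * clampInc (s i) (t i) z) ^ 2 * scaleWeight H z =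
      ∑ i, ∑ j, c i * c j * (clampInc (s i) (t i) z * clampInc (s j) (t j) z * scaleWeight H z) := by
  rw [sum_mul_sq_expand, Finset.sum_mul]
  refine Finset.sum_congr rfl fun i _ => ?_
  rw [Finset.sum_mul]
  exact Finset.sum_congr rfl fun j _ => by ring

lemma IsFractionalBM.integral_sum_sq_eq_clamp (hW : IsFractionalBM P H W) (h0 : 1 / 2 < H)
    (h1 : H < 1) {ι : Type} [Fintype ι]
    {s t : ι → ℝ} (hs : ∀ i, 0 ≤ s i) (ht : ∀ i, 0 ≤ t i) (c : ι → ℝ) :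
    clampMass H Set.univ * ∫ ω, (∑ i, c i * (W (t i) ω - W (s i) ω)) ^ 2 ∂P =
      ∫ z, (∑ i, c i * clampInc (s i) (t i) z) ^ 2 * scaleWeight H z := by
  rw [hW.integral_sum_sq hs ht]
  simp_rw [sum_clampInc_sq_expand]
  have hi := fun i j => (integrable_clampInc_mul h0 h1 (s i) (t i) (s j) (t j)).const_mul
    (c i * c j)
  rw [integral_finsetSum _ fun i _ => integrable_finsetSum _ fun j _ => hi i j, Finset.mul_sum]
  refine Finset.sum_congr rfl fun i _ => ?_
  rw [integral_finsetSum _ fun j _ => hi i j, Finset.mul_sum]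
  refine Finset.sum_congr rfl fun j _ => ?_
  rw [integral_const_mul, integral_clampInc_mul h0 h1,
    hW.integral_inc_mul_inc (hs i) (ht i) (hs j) (ht j)]
  ring

end FractionalBM

lemma sum_sq_clampInc_le {ι : Type} [Fintype ι] {s l : ι → ℝ} {M : ℝ} (hl : ∀ i, 0 < l i)
    (hsep : ∀ i j, i ≠ j → s i + l i + M * max (l i) (l j) ≤ s j ∨
      s j + l j + M * max (l i) (l j) ≤ s i) (hM : 0 ≤ M) (c : ι → ℝ) (z : ℝ × ℝ) :
    ∑ i, c i ^ 2 * ((Set.Iic M).indicator 1 ((l i)⁻¹ * z.2) * clampInc (s i) (s i + l i) z ^ 2) ≤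
      (∑ i, c i * clampInc (s i) (s i + l i) z) ^ 2 := by
  classical
  by_cases hex : ∃ i, clampInc (s i) (s i + l i) z ≠ 0 ∧ (l i)⁻¹ * z.2 ≤ M
  · obtain ⟨i, hi, hiM⟩ := hex
    have hother : ∀ j, j ≠ i → clampInc (s j) (s j + l j) z = 0 := by
      intro j hj
      by_contra hne
      obtain ⟨a1, a2⟩ := clampInc_ne_zero (by linarith [hl i]) hi
      obtain ⟨b1, b2⟩ := clampInc_ne_zero (by linarith [hl j]) hne
      have hr : z.2 ≤ M * l i := by
        rw [inv_mul_le_iff₀ (hl i)] at hiM; linarith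
      have hmax : M * l i ≤ M * max (l i) (l j) := by gcongr; exact le_max_left _ _
      rcases hsep i j hj.symm with h | h <;> linarith
    rw [Finset.sum_eq_single i, Finset.sum_eq_single i, mul_pow,
      Set.indicator_of_mem (Set.mem_Iic.mpr hiM)]
    · simp
    all_goals simp +contextual [hother]
  · push Not at hex
    refine (Finset.sum_eq_zero fun i _ => ?_).trans_le (sq_nonneg _)
    by_cases h : clampInc (s i) (s i + l i) z = 0
    · simp [h]
    · have : (l i)⁻¹ * z.2 ∉ Set.Iic M := not_le.mpr (hex i h)
      rw [Set.indicator_of_notMem this]; simp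

/-- Normalised increments of a fractional Brownian motion over intervals that are separated by gaps
much longer than the intervals themselves have almost full conditional variance. -/
lemma exists_separation {H : ℝ} (h0 : 1 / 2 < H) (h1 : H < 1) {κ : ℝ} (hκ : κ < 1) :
    ∃ M : ℝ, 0 < M ∧ ∀ {Ω : Type} [MeasurableSpace Ω] {P : Measure Ω} {W : ℝ → Ω → ℝ},
      IsFractionalBM P H W → ∀ {ι : Type} [Fintype ι] (s l : ι → ℝ), (∀ i, 0 ≤ s i) →
      (∀ i, 0 < l i) →
      (∀ i j, i ≠ j → s i + l i + M * max (l i) (l j) ≤ s j ∨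
        s j + l j + M * max (l i) (l j) ≤ s i) →
      ∀ c : ι → ℝ, κ * ∑ i, c i ^ 2 ≤
        ∫ ω, (∑ i, c i * ((W (s i + l i) ω - W (s i) ω) / l i ^ H)) ^ 2 ∂P := by
  have hV := clampMass_univ_pos h0 h1
  obtain ⟨n, hn⟩ := ((tendsto_clampMass h0 h1).eventually_const_lt
    (show κ * clampMass H Set.univ < clampMass H Set.univ by nlinarith)).and
    (eventually_gt_atTop 0) |>.exists
  refine ⟨n, by exact_mod_cast hn.2, fun {Ω} _ {P W} hW {ι} _ s l hs hl hsep c => ?_⟩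
  have hnorm : ∀ ω, ∑ i, c i * ((W (s i + l i) ω - W (s i) ω) / l i ^ H) =
      ∑ i, (c i / l i ^ H) * (W (s i + l i) ω - W (s i) ω) := fun ω =>
    Finset.sum_congr rfl fun i _ => by ring
  simp_rw [hnorm]
  set d : ι → ℝ := fun i => c i / l i ^ H
  rw [← mul_le_mul_iff_of_pos_left hV,
    hW.integral_sum_sq_eq_clamp h0 h1 hs (fun i => add_nonneg (hs i) (hl i).le)]
  have hi := fun i => (integrable_indicator_clampInc_sq_affine h0 h1 (A := Set.Iic (n:ℝ))
    measurableSet_Iic (s := s i) (hl i)).const_mul (d i ^ 2)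
  calc clampMass H Set.univ * (κ * ∑ i, c i ^ 2)
      = ∑ i, c i ^ 2 * (κ * clampMass H Set.univ) := by rw [← Finset.sum_mul]; ring
    _ ≤ ∑ i, c i ^ 2 * clampMass H (Set.Iic n) := by gcongr; exact hn.1.le
    _ = ∑ i, ∫ z : ℝ × ℝ, d i ^ 2 * ((Set.Iic (n:ℝ)).indicator 1 ((l i)⁻¹ * z.2) *
          (clampInc (s i) (s i + l i) z ^ 2 * scaleWeight H z)) := by
        refine Finset.sum_congr rfl fun i _ => ?_
        rw [integral_const_mul, integral_indicator_clampInc_sq_affine _ (hl i), two_mul H,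
          Real.rpow_add (hl i)]
        have := Real.rpow_pos_of_pos (hl i) H
        simp only [d]
        field_simp
    _ = ∫ z : ℝ × ℝ, ∑ i, d i ^ 2 * ((Set.Iic (n:ℝ)).indicator 1 ((l i)⁻¹ * z.2) *
          (clampInc (s i) (s i + l i) z ^ 2 * scaleWeight H z)) :=
        (integral_finsetSum _ fun i _ => hi i).symm
    _ ≤ _ := by
        refine integral_mono (integrable_finsetSum _ fun i _ => hi i) ?_ fun z => ?_
        · refine Integrable.congr ?_ (Eventually.of_forall fun z =>
            (sum_clampInc_sq_expand H s (fun i => s i + l i) d z).symm)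
          exact integrable_finsetSum _ fun i _ => integrable_finsetSum _ fun j _ =>
            (integrable_clampInc_mul h0 h1 _ _ _ _).const_mul _
        · calc _ = (∑ i, d i ^ 2 * ((Set.Iic (n:ℝ)).indicator 1 ((l i)⁻¹ * z.2) *
                  clampInc (s i) (s i + l i) z ^ 2)) * scaleWeight H z := by
                rw [Finset.sum_mul]
                exact Finset.sum_congr rfl fun i _ => by ring
            _ ≤ _ := mul_le_mul_of_nonneg_right
                (sum_sq_clampInc_le hl hsep n.cast_nonneg d z) (scaleWeight_nonneg _ _)

lemma ae_frequently_lt_abs_of_gaussian {Ω : Type} [MeasurableSpace Ω] {P : Measure Ω}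
    [IsProbabilityMeasure P] (N : ℕ → ℕ) (ξ : ℕ → ℕ → Ω → ℝ) (hm : ∀ k j, Measurable (ξ k j))
    {κ : NNReal} (hκ : κ ≠ 0)
    (hG : ∀ m n (c : (Σ k : Fin n, Fin (N (m + k))) → ℝ), ∃ v : NNReal,
      P.map (fun ω => ∑ i, c i * ξ (m + i.1) i.2 ω) = gaussianReal 0 v)
    (hlow : ∀ m n (c : (Σ k : Fin n, Fin (N (m + k))) → ℝ),
      κ * ∑ i, c i ^ 2 ≤ ∫ ω, (∑ i, c i * ξ (m + i.1) i.2 ω) ^ 2 ∂P)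
    (u p : ℕ → ℝ) (hp0 : ∀ k, 0 ≤ p k)
    (hp : ∀ k, gaussianReal 0 κ (Set.Icc (-u k) (u k)) ≤ ENNReal.ofReal (Real.exp (-p k)))
    (hdiv : ¬ Summable fun k => N k * p k) :
    ∀ᵐ ω ∂P, ∃ᶠ k in atTop, ∃ j < N k, u k < |ξ k j ω| := by
  have hnull : ∀ m, P {ω | ∀ k, m ≤ k → ∀ j < N k, |ξ k j ω| ≤ u k} = 0 := by
    intro m
    have hle : ∀ n, P {ω | ∀ k, m ≤ k → ∀ j < N k, |ξ k j ω| ≤ u k} ≤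
        ENNReal.ofReal (Real.exp (-∑ k ∈ Finset.range n, N (m + k) * p (m + k))) := by
      intro n
      calc _ ≤ P {ω | ∀ i : (Σ k : Fin n, Fin (N (m + k))), |ξ (m + i.1) i.2 ω| ≤ u (m + i.1)} :=
            measure_mono fun ω (hω : ∀ k, m ≤ k → ∀ j < N k, |ξ k j ω| ≤ u k) i =>
              hω _ (Nat.le_add_right _ _) _ i.2.2
        _ ≤ ∏ i : (Σ k : Fin n, Fin (N (m + k))),
              gaussianReal 0 κ (Set.Icc (-u (m + i.1)) (u (m + i.1))) :=
            gaussian_box_le (fun i : (Σ k : Fin n, Fin (N (m + k))) => ξ (m + i.1) i.2)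
              (fun i => hm _ _) (hG m n) hκ (hlow m n) _
        _ ≤ ∏ i : (Σ k : Fin n, Fin (N (m + k))), ENNReal.ofReal (Real.exp (-p (m + i.1))) :=
            Finset.prod_le_prod' fun i _ => hp _
        _ = _ := by
            rw [← ENNReal.ofReal_prod_of_nonneg fun i _ => (Real.exp_pos _).le, ← Real.exp_sum,
              Fintype.sum_sigma, Finset.sum_range, ← Finset.sum_neg_distrib]
            simp
    have hdiv' : Tendsto (fun n => ∑ k ∈ Finset.range n, (N (m + k) * p (m + k) : ℝ)) atTop
        atTop := by
      refine (not_summable_iff_tendsto_nat_atTop_of_nonneg fun k =>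
        mul_nonneg (Nat.cast_nonneg _) (hp0 _)).mp fun h => hdiv ?_
      rw [← summable_nat_add_iff m]
      simpa only [add_comm] using h
    have hlim : Tendsto (fun n => ENNReal.ofReal (Real.exp
        (-∑ k ∈ Finset.range n, N (m + k) * p (m + k)))) atTop (nhds 0) := by
      rw [← ENNReal.ofReal_zero]
      exact ENNReal.tendsto_ofReal (Real.tendsto_exp_neg_atTop_nhds_zero.comp hdiv')
    exact le_antisymm (ge_of_tendsto' hlim hle) zero_le
  have hae : ∀ᵐ ω ∂P, ∀ m, ¬ ∀ k, m ≤ k → ∀ j < N k, |ξ k j ω| ≤ u k :=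
    ae_all_iff.mpr fun m => measure_eq_zero_iff_ae_notMem.mp (hnull m)
  filter_upwards [hae] with ω hω
  rw [frequently_atTop]
  intro m
  have := hω m
  push Not at this
  obtain ⟨k, hk, j, hj, h⟩ := this
  exact ⟨k, hk, j, hj, h⟩

/-- The squared normalisation `log (T / a T) + log log T`. -/
noncomputable def logLevel (a : ℝ → ℝ) (T : ℝ) : ℝ :=
  Real.log (T / a T) + Real.log (Real.log T)

section FractionalBM

variable {Ω : Type} [MeasurableSpace Ω] {P : Measure Ω} {H : ℝ} {W : ℝ → Ω → ℝ}

lemma IsFractionalBM.map_sum_eq_gaussianReal (hW : IsFractionalBM P H W) {ι : Type} [Fintype ι]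
    {t : ι → ℝ} (ht : ∀ i, 0 ≤ t i) (c : ι → ℝ) :
    ∃ v : NNReal, P.map (fun ω => ∑ i, c i * W (t i) ω) = gaussianReal 0 v := by
  let e := Fintype.equivFin ι
  obtain ⟨v, hv⟩ := hW.2.1 _ (fun i => t (e.symm i)) (fun i => c (e.symm i)) fun i => ht _
  refine ⟨v, ?_⟩
  rw [← hv]
  congr 1
  ext ω
  exact (Equiv.sum_comp e.symm fun i => c i * W (t i) ω).symm

lemma IsFractionalBM.map_sum_inc_eq_gaussianReal (hW : IsFractionalBM P H W) {ι : Type} [Fintype ι]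
    {s t : ι → ℝ} (hs : ∀ i, 0 ≤ s i) (ht : ∀ i, 0 ≤ t i) (c : ι → ℝ) :
    ∃ v : NNReal, P.map (fun ω => ∑ i, c i * (W (t i) ω - W (s i) ω)) = gaussianReal 0 v := by
  obtain ⟨v, hv⟩ := hW.map_sum_eq_gaussianReal (t := Sum.elim t s)
    (by rintro (i | i) <;> simp [hs, ht]) (Sum.elim c (-c))
  refine ⟨v, ?_⟩
  rw [← hv]
  congr 1
  ext ω
  simp only [Fintype.sum_sum_type, Sum.elim_inl, Sum.elim_inr, Pi.neg_apply,
    ← Finset.sum_add_distrib]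
  exact Finset.sum_congr rfl fun i _ => by ring

/-- If along `T = θ ^ k` there are at least `c₀ * T / a T` increments of length `a T`, and all these
increments together are close to independent, then the large-increment lower bound holds. -/
lemma IsFractionalBM.frequently_of_family [IsProbabilityMeasure P] (hW : IsFractionalBM P H W)
    {a : ℝ → ℝ} (ha : ∀ T : ℝ, 0 < T → 0 < a T ∧ a T ≤ T) {θ : ℝ} (hθ : 1 < θ)
    {ρ κ c₀ : ℝ} (hρ : 0 < ρ) (hκ : ρ ^ 2 < κ) (hc₀ : 0 < c₀) (N : ℕ → ℕ) (s : ℕ → ℕ → ℝ)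
    (hN : ∀ᶠ k in atTop, c₀ * (θ ^ k / a (θ ^ k)) ≤ N k)
    (hs : ∀ k j, j < N k → s k j ∈ Set.Icc 0 (θ ^ k - a (θ ^ k)))
    (hlow : ∀ m n (c : (Σ k : Fin n, Fin (N (m + k))) → ℝ),
      κ * ∑ i, c i ^ 2 ≤ ∫ ω, (∑ i, c i *
        ((W (s (m + i.1) i.2 + a (θ ^ (m + i.1 : ℕ))) ω - W (s (m + i.1) i.2) ω) /
          a (θ ^ (m + i.1 : ℕ)) ^ H)) ^ 2 ∂P) :
    ∀ᵐ ω ∂P, ∃ᶠ T in atTop, ∃ t ∈ Set.Icc 0 (T - a T),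
      ρ * (a T ^ H * Real.sqrt (2 * logLevel a T)) < |W (t + a T) ω - W t ω| := by
  have hθ0 : 0 < θ := one_pos.trans hθ
  have hlogθ : 0 < Real.log θ := Real.log_pos hθ
  have hT : ∀ k : ℕ, 0 < θ ^ k := fun k => pow_pos hθ0 k
  have hκ0 : 0 < κ := (sq_nonneg ρ).trans_lt hκ
  lift κ to NNReal using hκ0.le
  have hκne : κ ≠ 0 := by rintro rfl; simp at hκ0
  have hη : 0 < κ / ρ ^ 2 - 1 := by
    rw [sub_pos, one_lt_div (by positivity)]; exact hκ
  obtain ⟨c, hc, hcx⟩ := gaussianReal_Icc_le hκne hη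
  let u : ℕ → ℝ := fun k => ρ * Real.sqrt (2 * logLevel a (θ ^ k))
  let p : ℕ → ℝ := fun k =>
    c * Real.exp (-((1 + (κ / ρ ^ 2 - 1)) * u k ^ 2 / (2 * κ)))
  have hinf : Tendsto (fun k : ℕ => (k : ℝ) * Real.log θ) atTop atTop :=
    tendsto_natCast_atTop_atTop.atTop_mul_const hlogθ
  have hpk : ∀ᶠ k : ℕ in atTop, c * c₀ / Real.log θ * (1 / (k : ℝ)) ≤ N k * p k := by
    filter_upwards [hN, hinf.eventually_ge_atTop 1, eventually_gt_atTop 0] with k hNk hk hk0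
    have hak := ha _ (hT k)
    have hx : 1 ≤ θ ^ k / a (θ ^ k) := by rw [one_le_div hak.1]; exact hak.2
    have hL : 0 ≤ logLevel a (θ ^ k) := by
      refine add_nonneg (Real.log_nonneg hx) (Real.log_nonneg ?_)
      rwa [Real.log_pow]
    have hu : (1 + ((κ:ℝ) / ρ ^ 2 - 1)) * u k ^ 2 / (2 * κ) = logLevel a (θ ^ k) := by
      simp only [u, mul_pow]
      rw [Real.sq_sqrt (by positivity)]
      field_simp
      ring
    have hpe : p k = c * ((θ ^ k / a (θ ^ k))⁻¹ * (k * Real.log θ)⁻¹) := by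
      simp only [p]
      rw [hu, logLevel, neg_add, Real.exp_add, Real.exp_neg, Real.exp_neg,
        Real.exp_log (by linarith), Real.log_pow, Real.exp_log (by linarith)]
    have hp0 : 0 ≤ p k := by simp only [p]; positivity
    calc c * c₀ / Real.log θ * (1 / (k : ℝ)) = c₀ * (θ ^ k / a (θ ^ k)) * p k := by
          rw [hpe]
          have := hak.1
          have := hT k
          have : (0:ℝ) < k := by exact_mod_cast hk0
          field_simp
      _ ≤ _ := by gcongr
  have hdiv : ¬ Summable fun k => N k * p k := by
    intro hsum
    have h1 : Summable fun k : ℕ => c * c₀ / Real.log θ * (1 / (k : ℝ)) := by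
      refine Summable.of_norm_bounded_eventually_nat hsum ?_
      filter_upwards [hpk] with k hk
      rwa [Real.norm_of_nonneg (by positivity)]
    rw [summable_mul_left_iff (by positivity)] at h1
    exact Real.not_summable_one_div_natCast h1
  let s' : ℕ → ℕ → ℝ := fun k j => max 0 (s k j)
  have hs' : ∀ k j, j < N k → s' k j = s k j := fun k j hj => max_eq_right (hs k j hj).1
  have hs'0 : ∀ k j, 0 ≤ s' k j := fun k j => le_max_left _ _
  let ξ : ℕ → ℕ → Ω → ℝ := fun k j ω =>
    (W (s' k j + a (θ ^ k)) ω - W (s' k j) ω) / a (θ ^ k) ^ H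
  have main := ae_frequently_lt_abs_of_gaussian (P := P) N ξ
    (fun k j => ((hW.1 _).sub (hW.1 _)).div_const _) hκne ?_ ?_ u p ?_ (fun k => ?_) hdiv
  · filter_upwards [main] with ω hω
    refine (tendsto_pow_atTop_atTop_of_one_lt hθ).frequently (hω.mono ?_)
    rintro k ⟨j, hj, hlt⟩
    refine ⟨s k j, hs k j hj, ?_⟩
    have hpos : 0 < a (θ ^ k) ^ H := Real.rpow_pos_of_pos (ha _ (hT k)).1 _
    simp only [ξ, hs' k j hj, abs_div, abs_of_pos hpos, lt_div_iff₀ hpos, u] at hlt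
    linarith
  · intro m n c
    obtain ⟨v, hv⟩ := hW.map_sum_inc_eq_gaussianReal
      (s := fun i : (Σ k : Fin n, Fin (N (m + k))) => s' (m + i.1) i.2)
      (t := fun i => s' (m + i.1) i.2 + a (θ ^ (m + i.1 : ℕ))) (fun i => hs'0 _ _)
      (fun i => add_nonneg (hs'0 _ _) (ha _ (hT _)).1.le)
      (fun i => c i / a (θ ^ (m + i.1 : ℕ)) ^ H)
    refine ⟨v, ?_⟩
    rw [← hv]
    congr 1
    ext ω
    exact Finset.sum_congr rfl fun i _ => by simp only [ξ]; ring
  · intro m n c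
    refine (hlow m n c).trans_eq ?_
    refine integral_congr_ae (Eventually.of_forall fun ω => ?_)
    simp only [ξ]
    congr 1
    refine Finset.sum_congr rfl fun i _ => ?_
    rw [hs' _ _ i.2.2]
  · intro k; simp only [p]; positivity
  · exact hcx (u k) (by simp only [u]; positivity)

end FractionalBM

lemma sum_pow_le_of_injOn {ι : Type*} {s : Finset ι} {f : ι → ℕ} (hf : Set.InjOn f s) {q : ℝ}
    (hq0 : 0 ≤ q) (hq1 : q < 1) : ∑ i ∈ s, q ^ f i ≤ (1 - q)⁻¹ := by
  classical
  rw [← Finset.sum_image (f := fun n => q ^ n) hf, ← tsum_geometric_of_lt_one hq0 hq1]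
  exact (summable_geometric_of_lt_one hq0 hq1).sum_le_tsum _ fun i _ => pow_nonneg hq0 i

/-- A symmetric matrix with unit diagonal and geometrically small off-diagonal entries is bounded
below. -/
lemma le_sum_of_geometric_offDiag {ι : Type*} [Fintype ι] {e : ι → ℕ} (he : e.Injective)
    {A : ι → ι → ℝ} {D q : ℝ} (hD : 0 ≤ D) (hq0 : 0 ≤ q) (hq1 : q < 1) (hd : ∀ i, A i i = 1)
    (hA : ∀ i j, e i < e j → |A i j| ≤ D * q ^ (e j - e i)) (hsymm : ∀ i j, A i j = A j i)
    (c : ι → ℝ) :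
    (1 - 2 * D * (q * (1 - q)⁻¹)) * ∑ i, c i ^ 2 ≤ ∑ i, ∑ j, c i * c j * A i j := by
  classical
  let B : ι → ι → ℝ := fun i j =>
    (if e i < e j then D * q ^ (e j - e i) else 0) + (if e j < e i then D * q ^ (e i - e j) else 0)
  have hB : ∀ i j, B i j = B j i := fun i j => add_comm _ _
  have hhalf : ∀ i, ∑ j, (if e i < e j then D * q ^ (e j - e i) else 0) ≤
      D * (q * (1 - q)⁻¹) := by
    intro i
    rw [← Finset.sum_filter, ← Finset.mul_sum]
    gcongr
    calc _ = ∑ j with e i < e j, q * q ^ (e j - e i - 1) := by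
            refine Finset.sum_congr rfl fun j hj => ?_
            rw [Finset.mem_filter_univ] at hj
            rw [← pow_succ']
            congr 1
            lia
      _ ≤ _ := by
            rw [← Finset.mul_sum]
            gcongr
            refine sum_pow_le_of_injOn (fun j hj j' hj' h => he ?_) hq0 hq1
            simp only [Finset.coe_filter, Finset.mem_univ, true_and, Set.mem_ofPred_eq] at hj hj'
            lia
  have hhalf' : ∀ i, ∑ j, (if e j < e i then D * q ^ (e i - e j) else 0) ≤
      D * (q * (1 - q)⁻¹) := by
    intro i
    rw [← Finset.sum_filter, ← Finset.mul_sum]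
    gcongr
    calc _ = ∑ j with e j < e i, q * q ^ (e i - e j - 1) := by
            refine Finset.sum_congr rfl fun j hj => ?_
            rw [Finset.mem_filter_univ] at hj
            rw [← pow_succ']
            congr 1
            lia
      _ ≤ _ := by
            rw [← Finset.mul_sum]
            gcongr
            refine sum_pow_le_of_injOn (fun j hj j' hj' h => he ?_) hq0 hq1
            simp only [Finset.coe_filter, Finset.mem_univ, true_and, Set.mem_ofPred_eq] at hj hj'
            lia
  have hrow : ∀ i, ∑ j, B i j ≤ 2 * D * (q * (1 - q)⁻¹) := by
    intro i
    simp only [B, Finset.sum_add_distrib]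
    linarith [hhalf i, hhalf' i]
  have hterm : ∀ i j, (if i = j then c i ^ 2 else 0) - (c i ^ 2 * B i j + c j ^ 2 * B i j) / 2 ≤
      c i * c j * A i j := by
    intro i j
    rcases eq_or_ne i j with rfl | hij
    · simp [B, hd, sq]
    · have hAB : |A i j| ≤ B i j := by
        rcases lt_or_gt_of_ne (he.ne hij) with h | h
        · simpa [B, h, h.not_gt] using hA i j h
        · rw [hsymm]
          simpa [B, h, h.not_gt] using hA j i h
      have h1 : |c i * c j| ≤ (c i ^ 2 + c j ^ 2) / 2 := by
        rw [abs_mul, ← sq_abs (c i), ← sq_abs (c j)]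
        nlinarith [sq_nonneg (|c i| - |c j|)]
      have h2 : |c i * c j * A i j| ≤ (c i ^ 2 + c j ^ 2) / 2 * B i j := by
        rw [abs_mul]
        exact mul_le_mul h1 hAB (abs_nonneg _) (by positivity)
      rw [if_neg hij]
      linarith [neg_abs_le (c i * c j * A i j)]
  have h1 : ∑ i, ∑ j, c i ^ 2 * B i j ≤ 2 * D * (q * (1 - q)⁻¹) * ∑ i, c i ^ 2 := by
    rw [Finset.mul_sum]
    refine Finset.sum_le_sum fun i _ => ?_
    rw [← Finset.mul_sum, mul_comm]
    exact mul_le_mul_of_nonneg_right (hrow i) (sq_nonneg _)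
  have h2 : ∑ i, ∑ j, c j ^ 2 * B i j = ∑ i, ∑ j, c i ^ 2 * B i j := by
    rw [Finset.sum_comm]
    simp_rw [hB]
  calc _ ≤ ∑ i, ∑ j, ((if i = j then c i ^ 2 else 0) -
        (c i ^ 2 * B i j + c j ^ 2 * B i j) / 2) := by
          simp only [Finset.sum_sub_distrib, ← Finset.sum_div, Finset.sum_add_distrib, h2]
          simp only [Finset.sum_ite_eq, Finset.mem_univ, if_true]
          linarith
    _ ≤ _ := Finset.sum_le_sum fun i _ => Finset.sum_le_sum fun j _ => hterm i j

/-- The correlation of a fractional Brownian motion at times `u ≤ v` decays like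
`(u / v) ^ (1 - H)`. -/
lemma abs_fbm_correlation_le {H : ℝ} (h0 : 1 / 2 < H) (h1 : H < 1) {u v : ℝ} (hu : 0 < u)
    (huv : u ≤ v) :
    |1 / 2 * (u ^ (2 * H) + v ^ (2 * H) - (v - u) ^ (2 * H)) / (u ^ H * v ^ H)| ≤
      3 / 2 * (u / v) ^ (1 - H) := by
  have hv : 0 < v := hu.trans_le huv
  set r := u / v with hr
  have hr0 : 0 < r := div_pos hu hv
  have hr1 : r ≤ 1 := (div_le_one hv).mpr huv
  have hur : u = r * v := by rw [hr]; field_simp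
  have hsub : v - u = (1 - r) * v := by rw [hur]; ring
  have hrH : 0 < r ^ H := Real.rpow_pos_of_pos hr0 _
  have hvH : 0 < v ^ H := Real.rpow_pos_of_pos hv _
  have hsq : ∀ x : ℝ, 0 < x → x ^ (2 * H) = x ^ H * x ^ H := fun x hx => by
    rw [← Real.rpow_add hx]; ring_nf
  have heq : 1 / 2 * (u ^ (2 * H) + v ^ (2 * H) - (v - u) ^ (2 * H)) / (u ^ H * v ^ H) =
      1 / 2 * (r ^ (2 * H) + (1 - (1 - r) ^ (2 * H))) / r ^ H := by
    rw [hsub, hur, Real.mul_rpow hr0.le hv.le, Real.mul_rpow hr0.le hv.le,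
      Real.mul_rpow (by linarith) hv.le, hsq v hv]
    field_simp
    ring
  have hb1 : 1 - 2 * H * r ≤ (1 - r) ^ (2 * H) := by
    have := one_add_mul_self_le_rpow_one_add (s := -r) (by linarith) (p := 2 * H) (by linarith)
    rw [← sub_eq_add_neg] at this
    linarith
  have hb2 : (1 - r) ^ (2 * H) ≤ 1 := Real.rpow_le_one (by linarith) (by linarith) (by linarith)
  have hmono : r ^ H ≤ r ^ (1 - H) := Real.rpow_le_rpow_of_exponent_ge hr0 hr1 (by linarith)
  have hsplit : r = r ^ H * r ^ (1 - H) := by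
    rw [← Real.rpow_add hr0]; simp
  have hr2 : 0 < r ^ (2 * H) := Real.rpow_pos_of_pos hr0 _
  rw [heq, abs_of_nonneg (by have : 0 ≤ r ^ (2 * H) + (1 - (1 - r) ^ (2 * H)) := by linarith
                             positivity), div_le_iff₀ hrH]
  have h3 : r ^ (2 * H) ≤ r := by
    nth_rewrite 2 [hsplit]
    rw [hsq r hr0]
    gcongr
  nlinarith

lemma div_self_le_div_self {a : ℝ → ℝ} (ha : ∀ T : ℝ, 0 < T → 0 < a T ∧ a T ≤ T)
    (haT : AntitoneOn (fun T => a T / T) (Set.Ioi (0:ℝ))) {S T : ℝ} (hS : 0 < S) (hST : S ≤ T) :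
    S / a S ≤ T / a T := by
  have hT := hS.trans_le hST
  have h := haT hS hT hST
  simp only at h
  rwa [← inv_div, ← inv_div S, inv_le_inv₀ (div_pos hT (ha _ hT).1) (div_pos hS (ha _ hS).1)] at h

section FractionalBM

variable {Ω : Type} [MeasurableSpace Ω] {P : Measure Ω} {H : ℝ} {W : ℝ → Ω → ℝ}

lemma IsFractionalBM.frequently_of_ratio_tendsto [IsProbabilityMeasure P]
    (hW : IsFractionalBM P H W) (h0 : 1 / 2 < H) (h1 : H < 1) {a : ℝ → ℝ} (hamono : Monotone a)
    (ha : ∀ T : ℝ, 0 < T → 0 < a T ∧ a T ≤ T)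
    (hx : Tendsto (fun k : ℕ => (2:ℝ) ^ k / a (2 ^ k)) atTop atTop) {ρ : ℝ} (hρ0 : 0 < ρ)
    (hρ1 : ρ < 1) :
    ∀ᵐ ω ∂P, ∃ᶠ T in atTop, ∃ t ∈ Set.Icc 0 (T - a T),
      ρ * (a T ^ H * Real.sqrt (2 * logLevel a T)) < |W (t + a T) ω - W t ω| := by
  have hρ2 : ρ ^ 2 < 1 := by nlinarith
  obtain ⟨M, hM, hsep⟩ := exists_separation h0 h1 (κ := (ρ ^ 2 + 1) / 2) (by linarith)
  have hT : ∀ k : ℕ, (0:ℝ) < 2 ^ k := fun k => by positivity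
  have hak : ∀ k : ℕ, 0 < a (2 ^ k) := fun k => (ha _ (hT k)).1
  let y : ℕ → ℝ := fun k => 2 ^ k / a (2 ^ k) / (2 * (M + 1))
  have hy0 : ∀ k, 0 ≤ y k := fun k => by have := hak k; positivity
  let N : ℕ → ℕ := fun k => ⌊y k⌋₊
  let s : ℕ → ℕ → ℝ := fun k j => 2 ^ k / 2 + M * a (2 ^ k) + j * ((M + 1) * a (2 ^ k))
  have hs0 : ∀ k j, 0 ≤ s k j := fun k j => by have := hak k; positivity
  have hend : ∀ k j, j < N k → s k j + a (2 ^ k) ≤ 2 ^ k := by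
    intro k j hj
    have h2 : ((j : ℝ) + 1) ≤ y k := by
      have : ((j + 1 : ℕ) : ℝ) ≤ y k := (Nat.le_floor_iff (hy0 k)).mp hj
      exact_mod_cast this
    have h3 : ((j : ℝ) + 1) * ((M + 1) * a (2 ^ k)) ≤ 2 ^ k / 2 := by
      have hpos := hak k
      calc _ ≤ y k * ((M + 1) * a (2 ^ k)) := by gcongr
        _ = _ := by simp only [y]; field_simp
    simp only [s]
    linarith
  refine hW.frequently_of_family ha one_lt_two hρ0 (κ := (ρ ^ 2 + 1) / 2)
    (c₀ := 1 / (4 * (M + 1))) (by linarith) (by positivity) N s ?_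
    (fun k j hj => ⟨hs0 k j, by linarith [hend k j hj]⟩) ?_
  · filter_upwards [hx.eventually_ge_atTop (4 * (M + 1))] with k hk
    have hyk : 2 ≤ y k := by
      simp only [y]
      rw [le_div_iff₀ (by positivity)]
      linarith
    have h4 : 1 / (4 * (M + 1)) * (2 ^ k / a (2 ^ k)) = y k / 2 := by
      simp only [y]; field_simp; norm_num
    rw [h4]
    have := Nat.lt_floor_add_one (y k)
    simp only [N]
    linarith
  · intro m n c
    refine hsep hW (fun i : (Σ k : Fin n, Fin (N (m + k))) => s (m + i.1) i.2)
      (fun i => a (2 ^ (m + i.1 : ℕ))) (fun i => hs0 _ _) (fun i => hak _) ?_ c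
    have hlt : ∀ i j : (Σ k : Fin n, Fin (N (m + k))), i.1 < j.1 →
        s (m + i.1) i.2 + a (2 ^ (m + i.1 : ℕ)) +
          M * max (a (2 ^ (m + i.1 : ℕ))) (a (2 ^ (m + j.1 : ℕ))) ≤ s (m + j.1) j.2 := by
      intro i j hij
      have hle : m + (i.1 : ℕ) + 1 ≤ m + j.1 := by
        have : (i.1 : ℕ) < j.1 := hij
        lia
      have hmono : a (2 ^ (m + i.1 : ℕ)) ≤ a (2 ^ (m + j.1 : ℕ)) :=
        hamono (pow_le_pow_right₀ one_le_two (by lia))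
      rw [max_eq_right hmono]
      have hp : (2:ℝ) ^ (m + i.1 : ℕ) ≤ 2 ^ (m + j.1 : ℕ) / 2 := by
        rw [le_div_iff₀ two_pos, ← pow_succ]
        exact pow_le_pow_right₀ one_le_two hle
      have he := hend (m + i.1) i.2 i.2.2
      have hpos := hak (m + j.1)
      have : (0:ℝ) ≤ (i.2 : ℝ) := Nat.cast_nonneg _
      have h5 : (2:ℝ) ^ (m + j.1 : ℕ) / 2 + M * a (2 ^ (m + j.1 : ℕ)) ≤ s (m + j.1) j.2 := by
        simp only [s]
        have : 0 ≤ (j.2 : ℝ) * ((M + 1) * a (2 ^ (m + j.1 : ℕ))) := by positivity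
        linarith
      linarith
    have hsame : ∀ k j j' : ℕ, j < j' →
        s k j + a (2 ^ k) + M * max (a (2 ^ k)) (a (2 ^ k)) ≤ s k j' := by
      intro k j j' hjj
      have h6 : (j : ℝ) + 1 ≤ j' := by exact_mod_cast hjj
      have hpos : 0 < (M + 1) * a (2 ^ k) := mul_pos (by linarith) (hak k)
      rw [max_self]
      simp only [s]
      nlinarith
    rintro ⟨k, i⟩ ⟨k', i'⟩ hne
    rcases lt_trichotomy k k' with h | h | h
    · exact Or.inl (hlt ⟨k, i⟩ ⟨k', i'⟩ h)
    · subst h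
      have hii : (i : ℕ) ≠ i' := fun h => hne (by rw [Fin.ext h])
      rcases lt_or_gt_of_ne hii with h | h
      · exact Or.inl (hsame _ _ _ h)
      · exact Or.inr (hsame _ _ _ h)
    · right
      have := hlt ⟨k', i'⟩ ⟨k, i⟩ h
      rwa [max_comm] at this

lemma IsFractionalBM.frequently_of_ratio_le [IsProbabilityMeasure P]
    (hW : IsFractionalBM P H W) (h0 : 1 / 2 < H) (h1 : H < 1) {a : ℝ → ℝ} (hamono : Monotone a)
    (ha : ∀ T : ℝ, 0 < T → 0 < a T ∧ a T ≤ T) {C : ℝ} (hC : 0 < C)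
    (hx : ∀ T : ℝ, 0 < T → T / a T ≤ C) {ρ : ℝ} (hρ0 : 0 < ρ) (hρ1 : ρ < 1) :
    ∀ᵐ ω ∂P, ∃ᶠ T in atTop, ∃ t ∈ Set.Icc 0 (T - a T),
      ρ * (a T ^ H * Real.sqrt (2 * logLevel a T)) < |W (t + a T) ω - W t ω| := by
  have hρ2 : ρ ^ 2 < 1 := by nlinarith
  set κ := (ρ ^ 2 + 1) / 2 with hκ
  have h1H : 0 < 1 - H := by linarith
  set D := 3 / 2 * C ^ (1 - H) with hDdef
  have hD : 0 < D := by positivity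
  set q := min (1 / 2) ((1 - κ) / (4 * D)) with hq
  have hκ1 : 0 < 1 - κ := by rw [hκ]; linarith
  have hq0 : 0 < q := lt_min (by norm_num) (by positivity)
  have hq1 : q ≤ 1 / 2 := min_le_left _ _
  have hqD : 2 * D * (q * (1 - q)⁻¹) ≤ 1 - κ := by
    have h2 : q ≤ (1 - κ) / (4 * D) := min_le_right _ _
    rw [le_div_iff₀ (by positivity)] at h2
    have h3 : (1 - q)⁻¹ ≤ 2 := by
      rw [inv_le_comm₀ (by linarith) two_pos]
      linarith
    calc 2 * D * (q * (1 - q)⁻¹) ≤ 2 * D * (q * 2) := by gcongr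
      _ ≤ _ := by linarith
  set θ := q ^ (-(1 - H)⁻¹) with hθdef
  have hθ : 1 < θ := Real.one_lt_rpow_of_pos_of_lt_one_of_neg hq0 (by linarith)
    (neg_neg_of_pos (inv_pos.mpr h1H))
  have hθ0 : 0 < θ := one_pos.trans hθ
  have hθq : θ⁻¹ ^ (1 - H) = q := by
    rw [hθdef, ← Real.rpow_neg hq0.le, neg_neg, ← Real.rpow_mul hq0.le, inv_mul_cancel₀ h1H.ne',
      Real.rpow_one]
  have hT : ∀ k : ℕ, 0 < θ ^ k := fun k => by positivity
  have hak : ∀ k : ℕ, 0 < a (θ ^ k) := fun k => (ha _ (hT k)).1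
  have hratio : ∀ k d : ℕ, (a (θ ^ k) / a (θ ^ (k + d))) ^ (1 - H) ≤ C ^ (1 - H) * q ^ d := by
    intro k d
    have hle : a (θ ^ k) / a (θ ^ (k + d)) ≤ C * θ⁻¹ ^ d := by
      rw [div_le_iff₀ (hak _)]
      have h4 := hx _ (hT (k + d))
      rw [div_le_iff₀ (hak _), pow_add] at h4
      calc a (θ ^ k) ≤ θ ^ k := (ha _ (hT k)).2
        _ = θ⁻¹ ^ d * (θ ^ k * θ ^ d) := by rw [inv_pow]; field_simp
        _ ≤ θ⁻¹ ^ d * (C * a (θ ^ (k + d))) := by rw [pow_add]; gcongr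
        _ = _ := by ring
    calc _ ≤ (C * θ⁻¹ ^ d) ^ (1 - H) :=
          Real.rpow_le_rpow (div_pos (hak _) (hak _)).le hle h1H.le
      _ = _ := by
          rw [Real.mul_rpow hC.le (by positivity), ← Real.rpow_natCast, ← Real.rpow_mul
            (by positivity), mul_comm (d : ℝ), Real.rpow_mul (by positivity), hθq,
            Real.rpow_natCast]
  refine hW.frequently_of_family ha hθ hρ0 (κ := κ) (c₀ := C⁻¹) (by rw [hκ]; linarith)
    (by positivity) (fun _ => 1) (fun _ _ => 0) ?_
    (fun k j hj => ⟨le_rfl, by linarith [(ha _ (hT k)).2]⟩) ?_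
  · refine Eventually.of_forall fun k => ?_
    rw [inv_mul_le_iff₀ hC]
    simpa using hx _ (hT k)
  · intro m n c
    let l : (Σ _ : Fin n, Fin 1) → ℝ := fun i => a (θ ^ (m + i.1 : ℕ))
    have hl : ∀ i, 0 < l i := fun i => hak _
    have hlH : ∀ i, 0 < l i ^ H := fun i => Real.rpow_pos_of_pos (hl i) _
    let A : (Σ _ : Fin n, Fin 1) → (Σ _ : Fin n, Fin 1) → ℝ := fun i j =>
      1 / 2 * (l i ^ (2 * H) + l j ^ (2 * H) - |l j - l i| ^ (2 * H)) / (l i ^ H * l j ^ H)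
    have hquad : ∫ ω, (∑ i, c i * ((W (0 + l i) ω - W 0 ω) / l i ^ H)) ^ 2 ∂P =
        ∑ i, ∑ j, c i * c j * A i j := by
      have h5 := hW.integral_sum_sq (s := fun _ => 0) (t := l) (fun _ => le_rfl)
        (fun i => (hl i).le) (fun i => c i / l i ^ H)
      calc _ = ∫ ω, (∑ i, c i / l i ^ H * (W (l i) ω - W 0 ω)) ^ 2 ∂P := by
            simp only [zero_add, div_mul_eq_mul_div, mul_div_assoc]
        _ = _ := by
            rw [h5]
            refine Finset.sum_congr rfl fun i _ => Finset.sum_congr rfl fun j _ => ?_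
            rw [hW.integral_inc_mul_inc le_rfl (hl i).le le_rfl (hl j).le]
            simp only [A, sub_zero, abs_zero, abs_of_pos (hl _),
              Real.zero_rpow (by linarith : 2 * H ≠ 0)]
            have := hlH i
            have := hlH j
            field_simp
            ring
    refine (le_trans ?_ (le_sum_of_geometric_offDiag (e := fun i => (i.1 : ℕ)) (A := A)
      ?_ hD.le hq0.le (by linarith) ?_ ?_ ?_ c)).trans_eq hquad.symm
    · exact mul_le_mul_of_nonneg_right (by linarith) (Finset.sum_nonneg fun i _ => sq_nonneg _)
    · rintro ⟨k, i⟩ ⟨k', i'⟩ h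
      obtain rfl : k = k' := Fin.ext h
      rw [Subsingleton.elim i i']
    · intro i
      have h6 : l i ^ (2 * H) = l i ^ H * l i ^ H := by
        rw [← Real.rpow_add (hl i)]; ring_nf
      have := hlH i
      simp only [A, sub_self, abs_zero, Real.zero_rpow (by linarith : 2 * H ≠ 0), h6]
      field_simp
      norm_num
      ring
    · intro i j hij
      have hij' : (i.1 : ℕ) < j.1 := hij
      have hmono : l i ≤ l j := hamono (pow_le_pow_right₀ hθ.le (by lia))
      have h7 := abs_fbm_correlation_le h0 h1 (hl i) hmono
      simp only [A, abs_of_nonneg (sub_nonneg.mpr hmono)]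
      refine h7.trans ?_
      have h8 := hratio (m + i.1) (j.1 - i.1)
      rw [show m + (i.1 : ℕ) + (j.1 - i.1) = m + j.1 by lia] at h8
      rw [hDdef, mul_assoc]
      gcongr
    · intro i j
      simp only [A, abs_sub_comm (l j)]
      ring

/-- The lower half of Ortega's theorem. -/
lemma IsFractionalBM.frequently_lt_increment [IsProbabilityMeasure P]
    (hW : IsFractionalBM P H W) (h0 : 1 / 2 < H) (h1 : H < 1) {a : ℝ → ℝ} (hamono : Monotone a)
    (ha : ∀ T : ℝ, 0 < T → 0 < a T ∧ a T ≤ T)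
    (haT : AntitoneOn (fun T => a T / T) (Set.Ioi (0:ℝ))) {ρ : ℝ} (hρ0 : 0 < ρ) (hρ1 : ρ < 1) :
    ∀ᵐ ω ∂P, ∃ᶠ T in atTop, ∃ t ∈ Set.Icc 0 (T - a T),
      ρ * (a T ^ H * Real.sqrt (2 * logLevel a T)) < |W (t + a T) ω - W t ω| := by
  by_cases hb : ∃ C, ∀ T : ℝ, 0 < T → T / a T ≤ C
  · obtain ⟨C, hC⟩ := hb
    refine hW.frequently_of_ratio_le h0 h1 hamono ha ?_ hC hρ0 hρ1
    exact (div_pos one_pos (ha 1 one_pos).1).trans_le (hC 1 one_pos)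
  · refine hW.frequently_of_ratio_tendsto h0 h1 hamono ha ?_ hρ0 hρ1
    push Not at hb
    rw [tendsto_atTop]
    intro C
    obtain ⟨T, hT, hlt⟩ := hb C
    filter_upwards [(tendsto_pow_atTop_atTop_of_one_lt (one_lt_two (α := ℝ))).eventually_ge_atTop T]
      with k hk
    exact hlt.le.trans (div_self_le_div_self ha haT hT hk)

end FractionalBM

/-- Dyadic chaining: control of dyadic increments controls the oscillation on an interval. -/
lemma abs_sub_le_tsum_of_dyadic {f : ℝ → ℝ} (hf : Continuous f) {g h : ℝ} {τ : ℕ → ℝ}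
    (hτ : Summable τ) (hτ0 : ∀ n, 0 ≤ τ n)
    (hinc : ∀ n i : ℕ, i ≤ 2 ^ n →
      |f (g + h * (((i : ℝ) + 1) / 2 ^ n)) - f (g + h * (i / 2 ^ n))| ≤ τ n)
    {y : ℝ} (hy : y ∈ Set.Icc (0:ℝ) 1) : |f (g + h * y) - f g| ≤ ∑' n, τ n := by
  let p : ℕ → ℝ := fun n => g + h * (⌊2 ^ n * y⌋₊ / 2 ^ n)
  have hfl : ∀ n : ℕ, (⌊(2:ℝ) ^ n * y⌋₊ : ℕ) ≤ 2 ^ n := by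
    intro n
    refine Nat.floor_le_of_le ?_
    have : (2:ℝ) ^ n * y ≤ 2 ^ n * 1 := by gcongr; exact hy.2
    push_cast
    linarith
  have hbound : ∀ n, |f (p n) - f g| ≤ ∑ m ∈ Finset.range (n + 1), τ m := by
    intro n
    induction n with
    | zero =>
      have h1 : ⌊y⌋₊ ≤ 1 := by simpa using hfl 0
      have h2 := hinc 0 0 (by simp)
      rcases Nat.le_one_iff_eq_zero_or_eq_one.mp h1 with h | h
      · simpa [p, h] using hτ0 0
      · simpa [p, h] using h2
    | succ n ih =>
      have hstep : |f (p (n + 1)) - f (p n)| ≤ τ (n + 1) := by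
        set i := ⌊(2:ℝ) ^ n * y⌋₊ with hi
        have hpn : p n = g + h * (((2 * i : ℕ) : ℝ) / 2 ^ (n + 1)) := by
          simp only [p, ← hi]
          rw [pow_succ]
          push_cast
          congr 2
          field_simp
        have hnn : (0:ℝ) ≤ 2 ^ n * y := mul_nonneg (by positivity) hy.1
        have hlo : 2 * i ≤ ⌊(2:ℝ) ^ (n + 1) * y⌋₊ := by
          refine Nat.le_floor ?_
          have := Nat.floor_le hnn
          rw [pow_succ]
          push_cast
          linarith
        have hhi : ⌊(2:ℝ) ^ (n + 1) * y⌋₊ < 2 * i + 2 := by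
          rw [Nat.floor_lt (by rw [pow_succ]; linarith)]
          have := Nat.lt_floor_add_one ((2:ℝ) ^ n * y)
          rw [pow_succ]
          push_cast
          linarith
        have hcases : ⌊(2:ℝ) ^ (n + 1) * y⌋₊ = 2 * i ∨ ⌊(2:ℝ) ^ (n + 1) * y⌋₊ = 2 * i + 1 := by
          lia
        rcases hcases with h' | h'
        · have : p (n + 1) = p n := by rw [hpn]; simp only [p, h']
          rw [this, sub_self, abs_zero]
          exact hτ0 _
        · rw [hpn]
          simp only [p, h']
          have h2i : 2 * i ≤ 2 ^ (n + 1) := by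
            have := hfl n
            rw [pow_succ]
            lia
          simpa using hinc (n + 1) (2 * i) h2i
      rw [Finset.sum_range_succ]
      calc _ = |(f (p (n + 1)) - f (p n)) + (f (p n) - f g)| := by rw [sub_add_sub_cancel]
        _ ≤ _ := (abs_add_le _ _).trans (by linarith)
  have hlim : Tendsto p atTop (nhds (g + h * y)) := by
    have h1 : Tendsto (fun n : ℕ => (⌊y * 2 ^ n⌋₊ : ℝ) / 2 ^ n) atTop (nhds y) :=
      (tendsto_nat_floor_mul_div_atTop hy.1).comp
        (tendsto_pow_atTop_atTop_of_one_lt (one_lt_two (α := ℝ)))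
    simp only [mul_comm y] at h1
    exact (h1.const_mul h).const_add g
  have hlim' : Tendsto (fun n => |f (p n) - f g|) atTop (nhds |f (g + h * y) - f g|) :=
    (((hf.tendsto _).comp hlim).sub_const _).abs
  exact le_of_tendsto' hlim' fun n => (hbound n).trans (hτ.sum_le_tsum _ fun i _ => hτ0 i)

/-- Oscillation over cells together with increments over a grid control all increments. -/
lemma abs_sub_le_of_grid {f : ℝ → ℝ} {δ S A B : ℝ} {R : ℕ} (hδ : 0 < δ)
    (hcell : ∀ i ≤ ⌊S / δ⌋₊, ∀ u ∈ Set.Icc (i * δ) (i * δ + δ), |f u - f (i * δ)| ≤ A)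
    (hgrid : ∀ i ≤ ⌊S / δ⌋₊, ∀ m ≤ R, |f (i * δ + m * δ) - f (i * δ)| ≤ B)
    {t s : ℝ} (ht : 0 ≤ t) (hs : s ∈ Set.Icc 0 (R * δ)) (hts : t + s ≤ S) :
    |f (t + s) - f t| ≤ 2 * A + B := by
  have hcl : ∀ v : ℝ, 0 ≤ v → v ≤ S →
      ⌊v / δ⌋₊ ≤ ⌊S / δ⌋₊ ∧ v ∈ Set.Icc (⌊v / δ⌋₊ * δ) (⌊v / δ⌋₊ * δ + δ) := by
    intro v hv hvS
    refine ⟨Nat.floor_le_floor (by gcongr), ?_, ?_⟩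
    · rw [← le_div_iff₀ hδ]
      exact Nat.floor_le (by positivity)
    · have := (Nat.lt_floor_add_one (v / δ)).le
      rw [div_le_iff₀ hδ] at this
      linarith
  obtain ⟨hi, hti⟩ := hcl t ht (by linarith [hs.1])
  obtain ⟨hj, htj⟩ := hcl (t + s) (by linarith [hs.1]) hts
  set i := ⌊t / δ⌋₊ with hidef
  set j := ⌊(t + s) / δ⌋₊ with hjdef
  have hij : i ≤ j := Nat.floor_le_floor (by gcongr; linarith [hs.1])
  have hjR : j - i ≤ R := by
    have h1 : (t + s) / δ < i + R + 1 := by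
      rw [div_lt_iff₀ hδ]
      have := Nat.lt_floor_add_one (t / δ)
      rw [← hidef, div_lt_iff₀ hδ] at this
      nlinarith [hs.2]
    have h2 : j < i + R + 1 := by
      rw [hjdef, Nat.floor_lt (by have := hs.1; positivity)]
      exact_mod_cast h1
    lia
  have h3 := hgrid i hi (j - i) hjR
  rw [← add_mul, Nat.cast_sub hij, add_sub_cancel] at h3
  have h4 := hcell i hi t hti
  have h5 := hcell j hj (t + s) htj
  rw [abs_le] at *
  constructor <;> linarith [h3.1, h3.2, h4.1, h4.2, h5.1, h5.2]

section FractionalBM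

variable {Ω : Type} [MeasurableSpace Ω] {P : Measure Ω} {H : ℝ} {W : ℝ → Ω → ℝ}

lemma IsFractionalBM.measure_abs_inc_gt_le [IsProbabilityMeasure P] (hW : IsFractionalBM P H W)
    (hH : 0 < H) {s t h x : ℝ} (hs : 0 ≤ s) (ht : 0 ≤ t) (hh : 0 < h) (hst : |t - s| ≤ h)
    (hx : 0 ≤ x) :
    P {ω | x * h ^ H < |W t ω - W s ω|} ≤ ENNReal.ofReal (2 * Real.exp (-(x ^ 2 / 2))) := by
  obtain ⟨v, hv⟩ := hW.map_sum_inc_eq_gaussianReal (ι := Unit) (s := fun _ => s) (t := fun _ => t)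
    (fun _ => hs) (fun _ => ht) (fun _ => 1)
  simp only [Finset.univ_unique, Finset.sum_singleton, one_mul] at hv
  have hm : Measurable fun ω => W t ω - W s ω := (hW.1 t).sub (hW.1 s)
  have hvar := integral_sq_of_map_gaussian hm hv
  simp only [sq] at hvar
  rw [hW.integral_inc_mul_inc hs ht hs ht] at hvar
  simp only [sub_self, abs_zero, Real.zero_rpow (by linarith : 2 * H ≠ 0)] at hvar
  have hhH : 0 < h ^ H := Real.rpow_pos_of_pos hh _
  have hV : (v : ℝ) ≤ (h ^ H) ^ 2 := by
    have h2 : |t - s| ^ (2 * H) ≤ h ^ (2 * H) :=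
      Real.rpow_le_rpow (abs_nonneg _) hst (by linarith)
    have h3 : h ^ (2 * H) = (h ^ H) ^ 2 := by
      rw [mul_comm, Real.rpow_mul hh.le]; norm_cast
    linarith
  refine (measure_abs_gt_le_of_map_gaussian hm hv (by positivity) hV
    (by positivity : 0 ≤ x * h ^ H)).trans_eq ?_
  congr 4
  field_simp

/-- Tail bound for the oscillation on an interval. -/
lemma IsFractionalBM.exists_oscillation_tail (hH : 0 < H) :
    ∃ K : ℝ, 0 < K ∧ ∀ {Ω : Type} [MeasurableSpace Ω] {P : Measure Ω} [IsProbabilityMeasure P]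
      {W : ℝ → Ω → ℝ}, IsFractionalBM P H W → ∀ {g h x : ℝ}, 0 ≤ g → 0 < h → 1 ≤ x →
      P {ω | ∃ u ∈ Set.Icc g (g + h), K * h ^ H * x < |W u ω - W g ω|} ≤
        ENNReal.ofReal (8 * Real.exp (-x ^ 2)) := by
  set r : ℝ := (1 / 2 : ℝ) ^ H with hr
  have hr0 : 0 < r := by positivity
  have hr1 : r < 1 := Real.rpow_lt_one (by norm_num) (by norm_num) hH
  have hsum : Summable fun n : ℕ => 2 * (1 + (n : ℝ)) * r ^ n := by
    have h1 := (summable_geometric_of_lt_one hr0.le hr1).mul_left 2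
    have h2 := (summable_pow_mul_geometric_of_norm_lt_one 1
      (by rwa [Real.norm_of_nonneg hr0.le] : ‖r‖ < 1)).mul_left 2
    refine (h1.add h2).congr fun n => ?_
    ring
  refine ⟨∑' n : ℕ, 2 * (1 + (n : ℝ)) * r ^ n,
    hsum.tsum_pos (fun n => by positivity) 0 (by simp), ?_⟩
  intro Ω _ P _ W hW g h x hg hh hx
  let y : ℕ → ℝ := fun n => 2 * x * (1 + n)
  let E : ℕ → ℕ → Set Ω := fun n i => {ω | y n * (h / 2 ^ n) ^ H <
    |W (g + h * (((i : ℝ) + 1) / 2 ^ n)) ω - W (g + h * (i / 2 ^ n)) ω|}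
  have hthr : ∀ n : ℕ, y n * (h / 2 ^ n) ^ H = h ^ H * x * (2 * (1 + (n : ℝ)) * r ^ n) := by
    intro n
    have : (h / 2 ^ n) ^ H = h ^ H * r ^ n := by
      rw [hr, Real.rpow_pow_comm (by norm_num), ← Real.mul_rpow hh.le (by positivity), one_div,
        inv_pow, div_eq_mul_inv]
    rw [this]
    simp only [y]
    ring
  have hsub : {ω | ∃ u ∈ Set.Icc g (g + h),
      (∑' n : ℕ, 2 * (1 + (n : ℝ)) * r ^ n) * h ^ H * x < |W u ω - W g ω|} ⊆
      ⋃ n : ℕ, ⋃ i ∈ Finset.range (2 ^ n + 1), E n i := by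
    rintro ω ⟨u, hu, hlt⟩
    by_contra hnot
    simp only [Set.mem_iUnion, not_exists, E, Set.mem_ofPred_eq, not_lt, Finset.mem_range,
      Nat.lt_succ_iff] at hnot
    refine hlt.not_ge ?_
    have huy : u = g + h * ((u - g) / h) := by field_simp; ring
    have h1 := abs_sub_le_tsum_of_dyadic (f := fun t => W t ω) (hW.2.2.2.2.1 ω) (g := g) (h := h)
      (τ := fun n => h ^ H * x * (2 * (1 + (n : ℝ)) * r ^ n)) (hsum.mul_left _)
      (fun n => by positivity) (fun n i hi => (hnot n i hi).trans_eq (hthr n))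
      (y := (u - g) / h) ⟨div_nonneg (by linarith [hu.1]) hh.le,
        (div_le_one hh).mpr (by linarith [hu.2])⟩
    rw [← huy, tsum_mul_left] at h1
    linarith
  have hE : ∀ n i, P (E n i) ≤ ENNReal.ofReal (2 * (Real.exp (-x ^ 2) * (1 / 4) ^ n)) := by
    intro n i
    have hp : (0:ℝ) < 2 ^ n := by positivity
    refine (hW.measure_abs_inc_gt_le hH (by positivity) (by positivity) (by positivity) ?_
      (by simp only [y]; positivity)).trans (ENNReal.ofReal_le_ofReal ?_)
    · rw [show g + h * (((i : ℝ) + 1) / 2 ^ n) - (g + h * (i / 2 ^ n)) = h / 2 ^ n by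
        field_simp; ring, abs_of_pos (by positivity)]
    · gcongr
      have h1 : -(y n ^ 2 / 2) ≤ -x ^ 2 + n * (-2) := by
        simp only [y]
        have hn : (0:ℝ) ≤ n := Nat.cast_nonneg _
        have hx2 : 1 ≤ x ^ 2 := by nlinarith
        nlinarith [mul_nonneg hn hn, mul_nonneg hn (sub_nonneg.mpr hx2),
          mul_nonneg (mul_nonneg hn hn) (sq_nonneg x)]
      have h2 : Real.exp (-2) ≤ 1 / 4 := by
        have := Real.add_one_le_exp (1:ℝ)
        rw [Real.exp_neg, show (2:ℝ) = 1 + 1 by norm_num, Real.exp_add, one_div]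
        exact inv_anti₀ (by norm_num) (by nlinarith)
      calc _ ≤ Real.exp (-x ^ 2 + n * (-2)) := Real.exp_le_exp.mpr h1
        _ = Real.exp (-x ^ 2) * Real.exp (-2) ^ n := by rw [Real.exp_add, Real.exp_nat_mul]
        _ ≤ _ := by gcongr
  have hgeo : Summable fun n : ℕ => 4 * Real.exp (-x ^ 2) * (1 / 2 : ℝ) ^ n :=
    (summable_geometric_of_lt_one (by norm_num) (by norm_num)).mul_left _
  calc _ ≤ P (⋃ n : ℕ, ⋃ i ∈ Finset.range (2 ^ n + 1), E n i) := measure_mono hsub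
    _ ≤ ∑' n : ℕ, P (⋃ i ∈ Finset.range (2 ^ n + 1), E n i) := measure_iUnion_le _
    _ ≤ ∑' n : ℕ, ENNReal.ofReal (4 * Real.exp (-x ^ 2) * (1 / 2 : ℝ) ^ n) := by
        refine ENNReal.tsum_le_tsum fun n => ?_
        calc _ ≤ ∑ i ∈ Finset.range (2 ^ n + 1), P (E n i) := measure_biUnion_finset_le _ _
          _ ≤ ∑ i ∈ Finset.range (2 ^ n + 1),
              ENNReal.ofReal (2 * (Real.exp (-x ^ 2) * (1 / 4) ^ n)) :=
                Finset.sum_le_sum fun i _ => hE n i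
          _ = ENNReal.ofReal ((2 ^ n + 1) * (2 * (Real.exp (-x ^ 2) * (1 / 4) ^ n))) := by
                rw [Finset.sum_const, Finset.card_range, ← ENNReal.ofReal_nsmul, nsmul_eq_mul]
                push_cast
                rfl
          _ ≤ _ := by
                refine ENNReal.ofReal_le_ofReal ?_
                have h1 : (1:ℝ) ≤ 2 ^ n := one_le_pow₀ one_le_two
                have h2 : (1 / 4 : ℝ) ^ n = (1 / 2) ^ n * (1 / 2) ^ n := by
                  rw [← mul_pow]; norm_num
                have h3 : (2:ℝ) ^ n * (1 / 2) ^ n = 1 := by rw [← mul_pow]; norm_num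
                calc _ ≤ (2 ^ n + 2 ^ n) * (2 * (Real.exp (-x ^ 2) * (1 / 4) ^ n)) := by gcongr
                  _ = 4 * Real.exp (-x ^ 2) * (1 / 2) ^ n * (2 ^ n * (1 / 2) ^ n) := by
                      rw [h2]; ring
                  _ = _ := by rw [h3, mul_one]
    _ = _ := by
        rw [← ENNReal.ofReal_tsum_of_nonneg (fun n => by positivity) hgeo, tsum_mul_left,
          tsum_geometric_of_lt_one (by norm_num) (by norm_num)]
        congr 1
        ring

/-- Tail bound for all increments of length at most `b` on `[0, S]`. -/
lemma IsFractionalBM.exists_large_increment_tail (hH : 0 < H) {η : ℝ} (hη : 0 < η) :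
    ∃ C : ℝ, 0 < C ∧ ∀ {Ω : Type} [MeasurableSpace Ω] {P : Measure Ω} [IsProbabilityMeasure P]
      {W : ℝ → Ω → ℝ}, IsFractionalBM P H W → ∀ {b S x : ℝ}, 0 < b → b ≤ S → 1 ≤ x →
      P {ω | ∃ t, 0 ≤ t ∧ ∃ s ∈ Set.Icc 0 b, t + s ≤ S ∧
          (1 + η) * (b ^ H * x) < |W (t + s) ω - W t ω|} ≤
        ENNReal.ofReal (C * (S / b) * Real.exp (-(x ^ 2 / 2))) := by
  obtain ⟨K, hK, htail⟩ := IsFractionalBM.exists_oscillation_tail hH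
  obtain ⟨R, hR1, hR⟩ : ∃ R : ℕ, 1 ≤ R ∧ 2 * K * (1 / (R : ℝ)) ^ H ≤ η := by
    have h1 : Tendsto (fun R : ℕ => 2 * K * (1 / (R : ℝ)) ^ H) atTop (nhds (2 * K * 0 ^ H)) :=
      ((tendsto_one_div_atTop_nhds_zero_nat (𝕜 := ℝ)).rpow_const (Or.inr hH.le)).const_mul _
    rw [Real.zero_rpow hH.ne', mul_zero] at h1
    obtain ⟨R, h2, h3⟩ := ((h1.eventually_le_const hη).and (eventually_ge_atTop 1)).exists
    exact ⟨R, h3, h2⟩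
  have hR0 : (0:ℝ) < R := by exact_mod_cast hR1
  refine ⟨2 * R * (10 + 2 * R), by positivity, ?_⟩
  intro Ω _ P _ W hW b S x hb hbS hx
  set δ := b / R with hδdef
  have hδ : 0 < δ := by positivity
  have hRδ : R * δ = b := by rw [hδdef]; field_simp
  let F : ℕ → Set Ω := fun i =>
    {ω | ∃ u ∈ Set.Icc (i * δ) (i * δ + δ), K * δ ^ H * x < |W u ω - W (i * δ) ω|}
  let G : ℕ → ℕ → Set Ω := fun i m =>
    {ω | x * b ^ H < |W (i * δ + m * δ) ω - W (i * δ) ω|}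
  set n := ⌊S / δ⌋₊ with hn
  have hsub : {ω | ∃ t, 0 ≤ t ∧ ∃ s ∈ Set.Icc 0 b, t + s ≤ S ∧
      (1 + η) * (b ^ H * x) < |W (t + s) ω - W t ω|} ⊆
      ⋃ i ∈ Finset.range (n + 1), (F i ∪ ⋃ m ∈ Finset.range (R + 1), G i m) := by
    rintro ω ⟨t, ht, s, hs, hts, hlt⟩
    by_contra hnot
    simp only [Set.mem_iUnion, Set.mem_union, not_exists, not_or, F, G, Set.mem_ofPred_eq, not_lt,
      Finset.mem_range, Nat.lt_succ_iff, not_and] at hnot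
    refine hlt.not_ge ?_
    have h1 := abs_sub_le_of_grid (f := fun t => W t ω) (S := S) (A := K * δ ^ H * x)
      (B := x * b ^ H) (R := R) hδ (fun i hi u hu => (hnot i hi).1 u hu)
      (fun i hi m hm => (hnot i hi).2 m hm) ht (by rwa [hRδ]) hts
    have h2 : δ ^ H = b ^ H * (1 / (R : ℝ)) ^ H := by
      rw [hδdef, ← Real.mul_rpow hb.le (by positivity)]
      congr 1
      ring
    have h3 : 2 * K * (1 / (R : ℝ)) ^ H * (b ^ H * x) ≤ η * (b ^ H * x) := by gcongr
    rw [h2] at h1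
    linarith
  have hF : ∀ i, P (F i) ≤ ENNReal.ofReal (8 * Real.exp (-(x ^ 2 / 2))) := by
    intro i
    refine (htail hW (by positivity) hδ hx).trans (ENNReal.ofReal_le_ofReal ?_)
    gcongr
    linarith [sq_nonneg x]
  have hG : ∀ i, ∀ m ∈ Finset.range (R + 1), P (G i m) ≤
      ENNReal.ofReal (2 * Real.exp (-(x ^ 2 / 2))) := by
    intro i m hm
    rw [Finset.mem_range, Nat.lt_succ_iff] at hm
    refine hW.measure_abs_inc_gt_le hH (by positivity) (by positivity) hb ?_ (by linarith)
    rw [add_sub_cancel_left, abs_of_nonneg (by positivity), ← hRδ]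
    gcongr
  calc _ ≤ P (⋃ i ∈ Finset.range (n + 1), (F i ∪ ⋃ m ∈ Finset.range (R + 1), G i m)) :=
        measure_mono hsub
    _ ≤ ∑ i ∈ Finset.range (n + 1), P (F i ∪ ⋃ m ∈ Finset.range (R + 1), G i m) :=
        measure_biUnion_finset_le _ _
    _ ≤ ∑ i ∈ Finset.range (n + 1), (ENNReal.ofReal (8 * Real.exp (-(x ^ 2 / 2))) +
          ∑ m ∈ Finset.range (R + 1), ENNReal.ofReal (2 * Real.exp (-(x ^ 2 / 2)))) := by
        refine Finset.sum_le_sum fun i _ => (measure_union_le _ _).trans (add_le_add (hF i) ?_)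
        exact (measure_biUnion_finset_le _ _).trans (Finset.sum_le_sum (hG i))
    _ = ENNReal.ofReal (((n : ℝ) + 1) * (8 * Real.exp (-(x ^ 2 / 2)) +
          ((R : ℝ) + 1) * (2 * Real.exp (-(x ^ 2 / 2))))) := by
        rw [Finset.sum_const, Finset.sum_const, Finset.card_range, Finset.card_range,
          ← ENNReal.ofReal_nsmul, ← ENNReal.ofReal_add (by positivity) (by positivity),
          ← ENNReal.ofReal_nsmul, nsmul_eq_mul, nsmul_eq_mul]
        push_cast
        rfl
    _ ≤ _ := by
        refine ENNReal.ofReal_le_ofReal ?_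
        have h1 : (n : ℝ) ≤ S / δ := Nat.floor_le (by have := hb.le.trans hbS; positivity)
        have h2 : S / δ = R * (S / b) := by rw [hδdef]; field_simp
        have h3 : 1 ≤ S / b := (one_le_div hb).mpr hbS
        have h4 : (1:ℝ) ≤ R := by exact_mod_cast hR1
        have h5 : (n : ℝ) + 1 ≤ 2 * R * (S / b) := by nlinarith
        calc _ = ((n : ℝ) + 1) * ((10 + 2 * R) * Real.exp (-(x ^ 2 / 2))) := by ring
          _ ≤ 2 * R * (S / b) * ((10 + 2 * R) * Real.exp (-(x ^ 2 / 2))) := by gcongr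
          _ = _ := by ring

/-- The upper half of Ortega's theorem. -/
lemma IsFractionalBM.eventually_increment_le [IsProbabilityMeasure P]
    (hW : IsFractionalBM P H W) (hH0 : 0 < H) (hH1 : H < 1) {a : ℝ → ℝ} (hamono : Monotone a)
    (ha : ∀ T : ℝ, 0 < T → 0 < a T ∧ a T ≤ T)
    (haT : AntitoneOn (fun T => a T / T) (Set.Ioi (0:ℝ))) {ρ : ℝ} (hρ : 1 < ρ) :
    ∀ᵐ ω ∂P, ∀ᶠ T in atTop, ∀ t ∈ Set.Icc 0 (T - a T), ∀ s ∈ Set.Icc 0 (a T),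
      |W (t + s) ω - W t ω| ≤ ρ * (a T ^ H * Real.sqrt (2 * logLevel a T)) := by
  set θ := ρ ^ (1 / 3 : ℝ) with hθdef
  have hθ : 1 < θ := Real.one_lt_rpow hρ (by norm_num)
  have hθ3 : θ * θ * θ = ρ := by
    rw [hθdef, ← Real.rpow_add (by linarith), ← Real.rpow_add (by linarith)]
    norm_num
  have hθ0 : 0 < θ := one_pos.trans hθ
  have hlogθ : 0 < Real.log θ := Real.log_pos hθ
  have hT : ∀ k : ℕ, 0 < θ ^ k := fun k => by positivity
  have hak : ∀ k : ℕ, 0 < a (θ ^ k) := fun k => (ha _ (hT k)).1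
  obtain ⟨C, hC, htail⟩ :=
    IsFractionalBM.exists_large_increment_tail hH0 (η := θ - 1) (by linarith)
  have hinf : Tendsto (fun k : ℕ => (k : ℝ) * Real.log θ) atTop atTop :=
    tendsto_natCast_atTop_atTop.atTop_mul_const hlogθ
  let x : ℕ → ℝ := fun k => θ * Real.sqrt (2 * logLevel a (θ ^ k))
  let E : ℕ → Set Ω := fun k => {ω | ∃ t, 0 ≤ t ∧ ∃ s ∈ Set.Icc 0 (a (θ ^ (k + 1))),
    t + s ≤ θ ^ (k + 1) ∧
      (1 + (θ - 1)) * (a (θ ^ (k + 1)) ^ H * x k) < |W (t + s) ω - W t ω|}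
  have hE : ∀ᶠ k : ℕ in atTop, P (E k) ≤
      ENNReal.ofReal (C * θ * (Real.log θ ^ θ)⁻¹ * (1 / (k : ℝ) ^ θ)) := by
    filter_upwards [hinf.eventually_ge_atTop (Real.exp 1), eventually_gt_atTop 0] with k hk hk0
    have hk0' : (0:ℝ) < k := by exact_mod_cast hk0
    have hkl : 0 < k * Real.log θ := by positivity
    have hx1 : 1 ≤ θ ^ k / a (θ ^ k) := (one_le_div (hak k)).mpr (ha _ (hT k)).2
    have hll : 1 ≤ Real.log (k * Real.log θ) := by rwa [Real.le_log_iff_exp_le hkl]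
    have hL : 1 ≤ logLevel a (θ ^ k) := by
      rw [logLevel, Real.log_pow]
      linarith [Real.log_nonneg hx1]
    have hxk : 1 ≤ x k := by
      have : 1 ≤ Real.sqrt (2 * logLevel a (θ ^ k)) := Real.one_le_sqrt.mpr (by linarith)
      simp only [x]
      nlinarith
    refine (htail hW (hak _) (ha _ (hT _)).2 hxk).trans (ENNReal.ofReal_le_ofReal ?_)
    have hratio : θ ^ (k + 1) / a (θ ^ (k + 1)) ≤ θ * (θ ^ k / a (θ ^ k)) := by
      rw [pow_succ', mul_div_assoc]
      have := hak k
      gcongr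
      rw [← pow_succ']
      exact hamono (pow_le_pow_right₀ hθ.le (Nat.le_succ k))
    have hsq : x k ^ 2 / 2 = θ ^ 2 * logLevel a (θ ^ k) := by
      simp only [x]
      rw [mul_pow, Real.sq_sqrt (by linarith)]
      ring
    have hexp : Real.exp (-(x k ^ 2 / 2)) ≤
        (θ ^ k / a (θ ^ k))⁻¹ * ((k * Real.log θ) ^ θ)⁻¹ := by
      have hrw : (θ ^ k / a (θ ^ k))⁻¹ * ((k * Real.log θ) ^ θ)⁻¹ =
          Real.exp (-(Real.log (θ ^ k / a (θ ^ k)) + Real.log (k * Real.log θ) * θ)) := by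
        rw [neg_add, Real.exp_add, Real.exp_neg, Real.exp_neg, Real.exp_log (by linarith),
          ← Real.rpow_def_of_pos hkl]
      rw [hrw, hsq, logLevel, Real.log_pow]
      have h1 := Real.log_nonneg hx1
      have h2 : θ ≤ θ ^ 2 := by nlinarith
      have h3 : 1 ≤ θ ^ 2 := by nlinarith
      refine Real.exp_le_exp.mpr (neg_le_neg ?_)
      rw [mul_add]
      refine add_le_add ?_ ?_
      · nlinarith
      · rw [mul_comm]
        gcongr
    have hxpos : 0 < θ ^ k / a (θ ^ k) := by linarith
    calc _ ≤ C * (θ * (θ ^ k / a (θ ^ k))) *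
          ((θ ^ k / a (θ ^ k))⁻¹ * ((k * Real.log θ) ^ θ)⁻¹) := by gcongr
      _ = _ := by
          rw [Real.mul_rpow hk0'.le hlogθ.le, mul_inv, one_div]
          calc _ = C * θ * (Real.log θ ^ θ)⁻¹ * ((k : ℝ) ^ θ)⁻¹ *
                ((θ ^ k / a (θ ^ k)) * (θ ^ k / a (θ ^ k))⁻¹) := by ring
            _ = _ := by rw [mul_inv_cancel₀ hxpos.ne', mul_one]
  have hsummable : Summable fun k : ℕ => C * θ * (Real.log θ ^ θ)⁻¹ * (1 / (k : ℝ) ^ θ) :=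
    (Real.summable_one_div_nat_rpow.mpr hθ).mul_left _
  have hBC : ∀ᵐ ω ∂P, ∀ᶠ k in atTop, ω ∉ E k := by
    obtain ⟨k₀, hk₀⟩ := eventually_atTop.mp hE
    have hfin : ∑' k, P (E (k + k₀)) ≠ ⊤ := by
      refine ne_top_of_le_ne_top ?_
        (ENNReal.tsum_le_tsum fun k => hk₀ (k + k₀) (Nat.le_add_left _ _))
      exact ((summable_nat_add_iff k₀).mpr hsummable).tsum_ofReal_ne_top
    filter_upwards [ae_eventually_notMem hfin] with ω hω
    obtain ⟨m, hm⟩ := eventually_atTop.mp hω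
    refine eventually_atTop.mpr ⟨m + k₀, fun k hk => ?_⟩
    have := hm (k - k₀) (by lia)
    rwa [Nat.sub_add_cancel (by lia)] at this
  filter_upwards [hBC] with ω hω
  obtain ⟨k₀, hk₀⟩ := eventually_atTop.mp hω
  filter_upwards [eventually_ge_atTop (θ ^ (k₀ + 1))] with T hTk t ht s hs
  have hTone : 1 < T := (one_lt_pow₀ hθ (Nat.succ_ne_zero _)).trans_le hTk
  obtain ⟨k, hkT, hTk'⟩ := exists_nat_pow_near hTone.le hθ
  have hkk : k₀ + 1 < k + 1 := (pow_lt_pow_iff_right₀ hθ).mp (hTk.trans_lt hTk')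
  have hnot := hk₀ k (by lia)
  simp only [E, Set.mem_ofPred_eq, not_exists, not_and, not_lt, add_sub_cancel] at hnot
  have h1 := hnot t ht.1 s ⟨hs.1, hs.2.trans (hamono hTk'.le)⟩ (by linarith [ht.2, hs.2])
  have hT0 : 0 < T := one_pos.trans hTone
  have haT0 := (ha T hT0).1
  have hb : a (θ ^ (k + 1)) ≤ θ * a T := by
    have h2 := haT (hT k) (hT (k + 1)) (pow_le_pow_right₀ hθ.le (Nat.le_succ k))
    simp only at h2
    rw [pow_succ', div_le_div_iff₀ (by positivity) (hT k), ← pow_succ'] at h2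
    have h3 : a (θ ^ (k + 1)) ≤ θ * a (θ ^ k) := by
      refine le_of_mul_le_mul_right (h2.trans_eq ?_) (hT k)
      rw [pow_succ']
      ring
    exact h3.trans (by gcongr; exact hamono hkT)
  have hbH : a (θ ^ (k + 1)) ^ H ≤ θ * a T ^ H := by
    calc _ ≤ (θ * a T) ^ H := Real.rpow_le_rpow (hak _).le hb hH0.le
      _ = θ ^ H * a T ^ H := Real.mul_rpow hθ0.le haT0.le
      _ ≤ _ := by
        gcongr
        exact Real.rpow_le_self_of_one_le hθ.le hH1.le
  have hL : logLevel a (θ ^ k) ≤ logLevel a T := by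
    have hlk : 0 < Real.log (θ ^ k) := Real.log_pos (one_lt_pow₀ hθ (by lia))
    have hxk : 0 < θ ^ k / a (θ ^ k) := div_pos (hT k) (hak k)
    exact add_le_add (Real.log_le_log hxk (div_self_le_div_self ha haT (hT k) hkT))
      (Real.log_le_log hlk (Real.log_le_log (hT k) hkT))
  calc _ ≤ θ * (a (θ ^ (k + 1)) ^ H * x k) := h1
    _ ≤ θ * ((θ * a T ^ H) * (θ * Real.sqrt (2 * logLevel a T))) := by
        simp only [x]
        gcongr
    _ = _ := by rw [← hθ3]; ring

end FractionalBM

lemma biSup_biSup_le {F : ℝ → ℝ → ℝ} {I J : Set ℝ} {B : ℝ} (hB : 0 ≤ B)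
    (h : ∀ t ∈ I, ∀ s ∈ J, F t s ≤ B) : ⨆ t ∈ I, ⨆ s ∈ J, F t s ≤ B :=
  Real.iSup_le (fun t => Real.iSup_le (fun ht => Real.iSup_le (fun s =>
    Real.iSup_le (fun hs => h t ht s hs) hB) hB) hB) hB

lemma le_biSup_biSup {F : ℝ → ℝ → ℝ} {I J : Set ℝ} {B : ℝ} (hB : 0 ≤ B)
    (h : ∀ t ∈ I, ∀ s ∈ J, F t s ≤ B) {t s : ℝ} (ht : t ∈ I) (hs : s ∈ J) :
    F t s ≤ ⨆ t ∈ I, ⨆ s ∈ J, F t s := by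
  have h1 : ∀ t ∈ I, ∀ s, ⨆ _ : s ∈ J, F t s ≤ B := fun t ht s =>
    Real.iSup_le (fun hs => h t ht s hs) hB
  have h2 : ∀ t, ⨆ _ : t ∈ I, ⨆ s ∈ J, F t s ≤ B := fun t =>
    Real.iSup_le (fun ht => Real.iSup_le (h1 t ht) hB) hB
  calc F t s = ⨆ _ : s ∈ J, F t s := by rw [ciSup_pos hs]
    _ ≤ ⨆ s ∈ J, F t s :=
        le_ciSup (f := fun s => ⨆ _ : s ∈ J, F t s) ⟨B, by rintro _ ⟨s, rfl⟩; exact h1 t ht s⟩ s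
    _ = ⨆ _ : t ∈ I, ⨆ s ∈ J, F t s := by rw [ciSup_pos ht]
    _ ≤ _ :=
        le_ciSup (f := fun t => ⨆ _ : t ∈ I, ⨆ s ∈ J, F t s) ⟨B, by rintro _ ⟨t, rfl⟩; exact h2 t⟩ t

lemma limsup_biSup_div_eq_one {F : ℝ → ℝ → ℝ} {I J : ℝ → Set ℝ} {D : ℝ → ℝ}
    (hF : ∀ t s, 0 ≤ F t s) (hD : ∀ᶠ T in atTop, 0 < D T)
    (hup : ∀ n : ℕ, ∀ᶠ T in atTop, ∀ t ∈ I T, ∀ s ∈ J T, F t s ≤ (1 + 1 / ((n : ℝ) + 1)) * D T)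
    (hlo : ∀ n : ℕ, ∃ᶠ T in atTop, ∃ t ∈ I T, ∃ s ∈ J T,
      (1 - 1 / ((n : ℝ) + 1 + 1)) * D T < F t s) :
    limsup (fun T => (⨆ t ∈ I T, ⨆ s ∈ J T, F t s) / D T) atTop = 1 := by
  have hle : ∀ n : ℕ, ∀ᶠ T in atTop,
      (⨆ t ∈ I T, ⨆ s ∈ J T, F t s) / D T ≤ 1 + 1 / ((n : ℝ) + 1) := by
    intro n
    filter_upwards [hD, hup n] with T hT h
    rw [div_le_iff₀ hT]
    exact biSup_biSup_le (by positivity) h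
  have hge : ∀ᶠ T in atTop, 0 ≤ (⨆ t ∈ I T, ⨆ s ∈ J T, F t s) / D T := by
    filter_upwards [hD] with T hT
    exact div_nonneg (Real.iSup_nonneg fun t => Real.iSup_nonneg fun _ =>
      Real.iSup_nonneg fun s => Real.iSup_nonneg fun _ => hF t s) hT.le
  have hfr : ∀ n : ℕ, ∃ᶠ T in atTop, 1 - 1 / ((n : ℝ) + 1 + 1) ≤
      (⨆ t ∈ I T, ⨆ s ∈ J T, F t s) / D T := by
    intro n
    refine ((hlo n).and_eventually (hD.and (hup 0))).mono ?_
    rintro T ⟨⟨t, ht, s, hs, hlt⟩, hT, h⟩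
    rw [le_div_iff₀ hT]
    exact hlt.le.trans (le_biSup_biSup (by positivity) h ht hs)
  have hlim := tendsto_one_div_add_atTop_nhds_zero_nat (𝕜 := ℝ)
  refine le_antisymm ?_ ?_
  · refine ge_of_tendsto' (by simpa using hlim.const_add 1) fun n => limsup_le_of_le ?_ (hle n)
    exact (isBoundedUnder_of_eventually_ge hge).isCoboundedUnder_le
  · have hlim' : Tendsto (fun n : ℕ => 1 - 1 / ((n : ℝ) + 1 + 1)) atTop (nhds 1) := by
      simpa using ((hlim.comp (tendsto_add_atTop_nat 1)).const_sub 1)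
    exact le_of_tendsto' hlim' fun n => le_limsup_of_frequently_le (hfr n)
      (isBoundedUnder_of_eventually_le (hle 0))

/-- Ortega's large-increment theorem: for a fractional Brownian
motion `W_H` with `H = 1 − α/2 ∈ (1/2, 1)` and `a_T` nondecreasing with
`0 < a_T ≤ T` and `a_T/T` nonincreasing,
`limsup_{T→∞} sup_{0≤t≤T−a_T} sup_{0≤s≤a_T} |W_H(t+s) − W_H(t)|
  / (a_T^H √(2(log(T/a_T) + log log T))) = 1` a.s. -/
theorem stmt_13
    {Ω : Type} [MeasurableSpace Ω] (P : Measure Ω) [IsProbabilityMeasure P]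
    (α : ℝ) (hα0 : 0 < α) (hα1 : α < 1)
    (W : ℝ → Ω → ℝ) (hW : IsFractionalBM P (1 - α / 2) W)
    (a : ℝ → ℝ) (hamono : Monotone a)
    (ha : ∀ T : ℝ, 0 < T → 0 < a T ∧ a T ≤ T)
    (haT : AntitoneOn (fun T => a T / T) (Set.Ioi (0:ℝ))) :
    ∀ᵐ ω ∂P,
      Filter.limsup
        (fun T : ℝ =>
          (⨆ t ∈ Set.Icc (0:ℝ) (T - a T), ⨆ s ∈ Set.Icc (0:ℝ) (a T),
            |W (t + s) ω - W t ω|) /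
          ((a T) ^ (1 - α / 2) *
            Real.sqrt (2 * (Real.log (T / a T) + Real.log (Real.log T)))))
        atTop = 1 := by
  have hup : ∀ᵐ ω ∂P, ∀ n : ℕ, ∀ᶠ T in atTop, ∀ t ∈ Set.Icc 0 (T - a T), ∀ s ∈ Set.Icc 0 (a T),
      |W (t + s) ω - W t ω| ≤ (1 + 1 / ((n : ℝ) + 1)) *
        (a T ^ (1 - α / 2) * Real.sqrt (2 * logLevel a T)) :=
    ae_all_iff.mpr fun n => hW.eventually_increment_le (by linarith) (by linarith) hamono ha haT
      (lt_add_of_pos_right 1 (by positivity))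
  have hlo : ∀ᵐ ω ∂P, ∀ n : ℕ, ∃ᶠ T in atTop, ∃ t ∈ Set.Icc 0 (T - a T),
      (1 - 1 / ((n : ℝ) + 1 + 1)) * (a T ^ (1 - α / 2) * Real.sqrt (2 * logLevel a T)) <
        |W (t + a T) ω - W t ω| := by
    refine ae_all_iff.mpr fun n => hW.frequently_lt_increment (by linarith) (by linarith) hamono ha
      haT ?_ (sub_lt_self 1 (by positivity))
    have hn : (0:ℝ) ≤ n := Nat.cast_nonneg n
    rw [sub_pos, div_lt_one (by positivity)]
    linarith
  have hD : ∀ᶠ T in atTop, 0 < a T ^ (1 - α / 2) * Real.sqrt (2 * logLevel a T) := by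
    filter_upwards [eventually_gt_atTop (Real.exp 1)] with T hT
    have hT0 : 0 < T := (Real.exp_pos 1).trans hT
    have haT0 := ha T hT0
    have h1 : 1 < Real.log T := by rwa [Real.lt_log_iff_exp_lt hT0]
    have h2 : 0 < logLevel a T := add_pos_of_nonneg_of_pos
      (Real.log_nonneg ((one_le_div haT0.1).mpr haT0.2)) (Real.log_pos h1)
    have h3 : 0 < a T ^ (1 - α / 2) := Real.rpow_pos_of_pos haT0.1 _
    positivity
  filter_upwards [hup, hlo] with ω h1 h2
  refine limsup_biSup_div_eq_one (F := fun t s => |W (t + s) ω - W t ω|)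
    (fun t s => abs_nonneg _) hD h1 fun n => ((h2 n).and_eventually (eventually_gt_atTop 0)).mono ?_
  rintro T ⟨⟨t, ht, hlt⟩, hT⟩
  exact ⟨t, ht, a T, ⟨(ha T hT).1.le, le_rfl⟩, hlt⟩
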